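/- Suppose X is a finite-dimensional vector space endowed with the trivial right H-action x◁ω = ε(ω)x. Then [Ψⁿ] : HC^n_H(B) → HC^n_H(End(X)⊗B) is an isomorphism, whose inverse is the map [Φⁿ_p] induced by the equivariant algebra homomorphism Φ_p : B → End(X)⊗B, Φ_p(b) = p⊗b, where p is any one-dimensional idempotent in End(X). -/

import Mathlib

open scoped TensorProduct

noncomputable section

/-- A Hopf `ℂ`-algebra with invertible antipode, together with a chosen finite
(Sweedler) representation of the comultiplication: `Δ ω = ∑_{p ∈ Δl ω} p.1 ⊗ p.2`. -/
structure HopfData (H : Type) [Ring H] [HopfAlgebra ℂ H] where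
  /-- the inverse of the antipode -/
  Sinv : H →ₗ[ℂ] H
  Sinv_antipode : ∀ ω : H, Sinv (HopfAlgebra.antipode (R := ℂ) ω) = ω
  antipode_Sinv : ∀ ω : H, HopfAlgebra.antipode (R := ℂ) (Sinv ω) = ω
  /-- a chosen list representation of the comultiplication -/
  Δl : H → List (H × H)
  Δl_repr : ∀ ω : H,
    (Coalgebra.comul (R := ℂ) ω : H ⊗[ℂ] H) = ((Δl ω).map fun p => p.1 ⊗ₜ[ℂ] p.2).sum

variable {H : Type} [Ring H] [HopfAlgebra ℂ H]

/-- the counit, as a `ℂ`-valued function -/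
def epsi (ω : H) : ℂ := Coalgebra.counit (R := ℂ) ω

/-- Iterated Sweedler decomposition: `sw n ω` represents
`Δⁿ ω = ∑_v v 0 ⊗ ⋯ ⊗ v n`, where `Δⁿ = (ι ⊗ Δ) Δ^{n-1}`. -/
def HopfData.sw (D : HopfData H) : (n : ℕ) → H → List (Fin (n + 1) → H)
  | 0, ω => [fun _ => ω]
  | n + 1, ω =>
    (D.sw n ω).flatMap fun v =>
      (D.Δl (v (Fin.last n))).map fun p =>
        Fin.snoc (Function.update v (Fin.last n) p.1) p.2

/-- A right `H`-module structure (over `ℂ`), recorded as the antihomomorphism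
`act : H → End(B)`, so `act ω b` stands for `b ◁ ω`. -/
structure RAct (H : Type) [Ring H] [HopfAlgebra ℂ H] (B : Type) [AddCommGroup B]
    [Module ℂ B] where
  act : H →ₗ[ℂ] B →ₗ[ℂ] B
  act_one : act 1 = LinearMap.id
  act_mul : ∀ ω η : H, act (ω * η) = (act η) ∘ₗ (act ω)

/-- A unital right `H`-module algebra structure on `B`:
`(b₁ b₂) ◁ ω = ∑ (b₁ ◁ ω₍₀₎)(b₂ ◁ ω₍₁₎)` and `1 ◁ ω = ε(ω) 1`. -/
structure MAlg (D : HopfData H) (B : Type) [Ring B] [Algebra ℂ B] extends RAct H B where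
  act_mul_mul : ∀ (ω : H) (b₁ b₂ : B),
    act ω (b₁ * b₂) = ((D.Δl ω).map fun p => act p.1 b₁ * act p.2 b₂).sum
  act_algOne : ∀ ω : H, act ω (1 : B) = epsi ω • (1 : B)


/-- the action as a plain function: `fn ω b = b ◁ ω` -/
def RAct.fn {H : Type} [Ring H] [HopfAlgebra ℂ H] {B : Type} [AddCommGroup B] [Module ℂ B]
    (A : RAct H B) : H → B → B := fun ω x => A.act ω x

/-- the action of a module algebra as a plain function -/
def MAlg.fn {H : Type} [Ring H] [HopfAlgebra ℂ H] {B : Type} [Ring B] [Algebra ℂ B]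
    {D : HopfData H} (A : MAlg D B) : H → B → B := A.toRAct.fn

/-- The space of `ℂ`-valued functions of one `H`-variable and `n+1` `B`-variables;
(multi)linear such functions correspond to linear functionals on `H ⊗ B^{⊗(n+1)}`. -/
abbrev Raw (H B : Type) (n : ℕ) := H → (Fin (n + 1) → B) → ℂ

section Raw

variable {H : Type} [Ring H] [HopfAlgebra ℂ H] {B : Type} [Ring B] [Algebra ℂ B] {n : ℕ}

/-- `f` is linear in the `H`-variable and in each `B`-variable separately, i.e. `f`
is (the restriction of) a linear functional on `H ⊗ B^{⊗(n+1)}`. -/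
def IsML (f : Raw H B n) : Prop :=
  (∀ ω η b, f (ω + η) b = f ω b + f η b) ∧
  (∀ (c : ℂ) ω b, f (c • ω) b = c * f ω b) ∧
  (∀ ω b (i : Fin (n + 1)) (x y : B),
    f ω (Function.update b i (x + y)) =
      f ω (Function.update b i x) + f ω (Function.update b i y)) ∧
  (∀ ω b (i : Fin (n + 1)) (c : ℂ) (x : B),
    f ω (Function.update b i (c • x)) = c * f ω (Function.update b i x))

/-- `H`-invariance of the functional `f` on `H ⊗ B^{⊗(n+1)}`:
`(ω ▷ f)(η ⊗ b₀ ⊗ ⋯ ⊗ bₙ) = f(S⁻¹(ω₍₀₎) η ω₍₁₎ ⊗ b₀ ◁ ω₍₂₎ ⊗ ⋯ ⊗ bₙ ◁ ω₍ₙ₊₂₎)`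
equals `ε(ω) f(η ⊗ b₀ ⊗ ⋯ ⊗ bₙ)`. -/
def IsInv (D : HopfData H) (act : H → B → B) (f : Raw H B n) : Prop :=
  ∀ (ω η : H) (b : Fin (n + 1) → B),
    ((D.sw (n + 2) ω).map fun v =>
        f (D.Sinv (v 0) * η * v 1) fun i => act (v i.succ.succ) (b i)).sum
      = epsi ω * f η b

/-- membership in the equivariant cochain space `C^n_H(B)` -/
def InC (D : HopfData H) (act : H → B → B) (f : Raw H B n) : Prop :=
  IsML f ∧ IsInv D act f

/-- the cyclic operator
`(tₙ f)(ω ⊗ b₀ ⊗ ⋯ ⊗ bₙ) = f(ω₍₀₎ ⊗ bₙ ◁ ω₍₁₎ ⊗ b₀ ⊗ ⋯ ⊗ b_{n-1})` -/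
def tRaw (D : HopfData H) (act : H → B → B) (f : Raw H B n) : Raw H B n :=
  fun ω b =>
    ((D.Δl ω).map fun p =>
      f p.1 (Fin.cons (act p.2 (b (Fin.last n))) fun i : Fin n => b i.castSucc)).sum

/-- merging the `i`-th and `(i+1)`-st entries of a `(n+2)`-tuple by multiplication -/
def contract (i : Fin (n + 1)) (b : Fin (n + 2) → B) : Fin (n + 1) → B :=
  fun j =>
    if (j : ℕ) < (i : ℕ) then b j.castSucc
    else if (j : ℕ) = (i : ℕ) then b j.castSucc * b j.succ
    else b j.succ

/-- the coface operators `dⁿᵢ : C^{n} → C^{n+1}` (`i < n+1` multiplies adjacent entries;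
the last one is `d_{n+1} = t ∘ d₀`) -/
def dRaw (D : HopfData H) (act : H → B → B) (i : Fin (n + 2)) (f : Raw H B n) :
    Raw H B (n + 1) :=
  if h : (i : ℕ) < n + 1 then fun ω b => f ω (contract ⟨i, h⟩ b)
  else tRaw D act fun ω b => f ω (contract 0 b)

/-- the codegeneracy operators `sⁿᵢ : C^{n+1} → C^n`, inserting a `1` after the `i`-th entry -/
def sRaw (i : Fin (n + 1)) (f : Raw H B (n + 1)) : Raw H B n :=
  fun ω b => f ω (Fin.insertNth i.succ 1 b)

/-- the Hochschild coboundary `b = ∑ (-1)ⁱ dᵢ` -/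
def bRaw (D : HopfData H) (act : H → B → B) (f : Raw H B n) : Raw H B (n + 1) :=
  fun ω b => ∑ i : Fin (n + 2), ((-1 : ℂ) ^ (i : ℕ)) * dRaw D act i f ω b

/-- cyclicity: `λ f = (-1)ⁿ tₙ f = f` -/
def IsCyc (D : HopfData H) (act : H → B → B) (f : Raw H B n) : Prop :=
  ∀ ω b, ((-1 : ℂ) ^ n) * tRaw D act f ω b = f ω b

/-- an `n`-cocycle of the cyclic complex `(Ker(1-λ), b)` computing `HC^n_H(B)` -/
def IsCocycle (D : HopfData H) (act : H → B → B) (f : Raw H B n) : Prop :=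
  InC D act f ∧ IsCyc D act f ∧ ∀ ω b, bRaw D act f ω b = 0

end Raw

section Mat

variable {H : Type} [Ring H] [HopfAlgebra ℂ H]

/-- A finite-dimensional right `H`-module, presented as a matrix antirepresentation
`π : H → Matrix ι ι ℂ` (so `x ◁ ω` is the row vector `x · π(ω)`). -/
structure MRep (H : Type) [Ring H] [HopfAlgebra ℂ H] (ι : Type) [Fintype ι]
    [DecidableEq ι] where
  π : H →ₗ[ℂ] Matrix ι ι ℂ
  π_one : π 1 = 1
  π_mul : ∀ ω η : H, π (ω * η) = π η * π ω

variable {B : Type} [Ring B] [Algebra ℂ B]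
variable {ι κ : Type} [Fintype ι] [DecidableEq ι] [Fintype κ] [DecidableEq κ]

/-- The right `H`-action on `Hom(X, X') ⊗ B` (realized as rectangular matrices over `B`):
`(T ⊗ b) ◀ ω = π'(ω₍₀₎) T π(S⁻¹(ω₍₂₎)) ⊗ b ◁ ω₍₁₎`. -/
def matActR (D : HopfData H) (P : MRep H ι) (P' : MRep H κ) (A : RAct H B) :
    H → Matrix κ ι B → Matrix κ ι B :=
  fun ω M =>
    ((D.sw 2 ω).map fun v =>
      ((P'.π (v 0)).map (algebraMap ℂ B)) *
        (M.map fun x => A.act (v 1) x) *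
          ((P.π (D.Sinv (v 2))).map (algebraMap ℂ B))).sum

/-- the right `H`-action on `End(X) ⊗ B`, realized as `Matrix ι ι B` -/
def matAct (D : HopfData H) (P : MRep H ι) (A : RAct H B) :
    H → Matrix ι ι B → Matrix ι ι B :=
  matActR D P P A

/-- The map `Ψⁿ : C^n_H(B) → C^n_H(End(X) ⊗ B)`,
`(Ψⁿ f)(ω ⊗ (T₀⊗b₀) ⊗ ⋯ ⊗ (Tₙ⊗bₙ)) = f(ω₍₀₎ ⊗ b₀ ⊗ ⋯ ⊗ bₙ) Tr(π(S⁻¹(ω₍₁₎)) T₀ ⋯ Tₙ)`,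
written out on matrices over `B`. -/
def PsiRaw (D : HopfData H) (P : MRep H ι) {n : ℕ} (f : Raw H B n) :
    Raw H (Matrix ι ι B) n :=
  fun ω M =>
    ((D.Δl ω).map fun p =>
      ∑ k : Fin (n + 2) → ι,
        (P.π (D.Sinv p.2)) (k (Fin.last (n + 1))) (k 0) *
          f p.1 fun i => M i (k i.castSucc) (k i.succ)).sum

/-- the right `H`-action on `X ⊗ B` (tensor product action), `X` realized as row
vectors with matrix antirepresentation `P` -/
def ractV (D : HopfData H) (P : MRep H ι) (A : RAct H B) (ω : H) (v : ι → B) : ι → B :=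
  fun j => ((D.Δl ω).map fun p => ∑ i, (P.π p.1) i j • A.act p.2 (v i)).sum

/-- membership in `R(H)`, the `H`-invariant linear functionals on `H` (with the
adjoint action `η ◁ ω = S⁻¹(ω₍₀₎) η ω₍₁₎`) -/
def IsRH (D : HopfData H) (F : H → ℂ) : Prop :=
  (∀ ω η : H, F (ω + η) = F ω + F η) ∧
  (∀ (c : ℂ) (ω : H), F (c • ω) = c * F ω) ∧
  (∀ ω η : H, ((D.Δl ω).map fun p => F (D.Sinv p.1 * η * p.2)).sum = epsi ω * F η)

end Mat

/-- the map `Φ_p : C^n_H(End(X) ⊗ B) → C^n_H(B)` induced by the equivariant algebra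
homomorphism `Φ_p(b) = p ⊗ b`, for an idempotent `p ∈ End(X)` -/
def phiRaw {H B : Type} [Ring B] [Algebra ℂ B] {ι : Type} [Fintype ι] [DecidableEq ι]
    (p : Matrix ι ι ℂ) {n : ℕ} (f : Raw H (Matrix ι ι B) n) : Raw H B n :=
  fun ω b => f ω fun k => Matrix.of fun i j => p i j • b k

set_option linter.unusedSectionVars false
set_option linter.unusedVariables false

namespace Mor

section Sweedler
variable {W : Type} [AddCommGroup W] [Module ℂ W]

/-- bundle a function that is linear in both variables -/
def mkBilin (F : H → H → W) (h1 : ∀ y, IsLinearMap ℂ fun x => F x y)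
    (h2 : ∀ x, IsLinearMap ℂ (F x)) : H →ₗ[ℂ] H →ₗ[ℂ] W :=
  LinearMap.mk₂ ℂ F (fun a b c => (h1 c).map_add a b) (fun r a c => (h1 c).map_smul r a)
    (fun a b c => (h2 a).map_add b c) (fun r a c => (h2 a).map_smul r c)

lemma dl_eq (D : HopfData H) (F : H → H → W) (h1 : ∀ y, IsLinearMap ℂ fun x => F x y)
    (h2 : ∀ x, IsLinearMap ℂ (F x)) (ω : H) :
    ((D.Δl ω).map fun p => F p.1 p.2).sum
      = TensorProduct.lift (mkBilin F h1 h2) (Coalgebra.comul (R := ℂ) ω) := by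
  rw [D.Δl_repr, map_list_sum, List.map_map]
  rfl

lemma dl_lin (D : HopfData H) (F : H → H → W) (h1 : ∀ y, IsLinearMap ℂ fun x => F x y)
    (h2 : ∀ x, IsLinearMap ℂ (F x)) :
    IsLinearMap ℂ fun ω => ((D.Δl ω).map fun p => F p.1 p.2).sum := by
  constructor
  · intro x y; simp only [dl_eq D F h1 h2, map_add]
  · intro c y; simp only [dl_eq D F h1 h2, map_smul]

lemma epsi_lin : IsLinearMap ℂ (epsi : H → ℂ) :=
  ⟨fun x y => by simp [epsi], fun x y => by simp [epsi]⟩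

lemma dl_counit_left (D : HopfData H) (F : H → W) (h : IsLinearMap ℂ F) (ω : H) :
    ((D.Δl ω).map fun p => epsi p.1 • F p.2).sum = F ω := by
  have := dl_eq D (fun a b => epsi a • F b)
    (fun y => ⟨fun a b => by simp [epsi_lin.map_add, add_smul],
      fun c a => by simp [epsi_lin.map_smul, mul_smul]⟩)
    (fun x => ⟨fun a b => by simp [h.map_add], fun c a => by simp [h.map_smul, smul_comm c]⟩) ω
  rw [this]
  have h2 : TensorProduct.lift (mkBilin (fun a b => epsi a • F b)
    (fun y => ⟨fun a b => by simp [epsi_lin.map_add, add_smul],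
      fun c a => by simp [epsi_lin.map_smul, mul_smul]⟩)
    (fun x => ⟨fun a b => by simp [h.map_add], fun c a => by simp [h.map_smul, smul_comm c]⟩))
    = (h.mk' F) ∘ₗ (TensorProduct.lid ℂ H).toLinearMap ∘ₗ
      (Coalgebra.counit (R := ℂ) (A := H)).rTensor H := by
    ext a b
    simp [mkBilin, epsi]
  rw [h2]
  simp

lemma dl_counit_right (D : HopfData H) (F : H → W) (h : IsLinearMap ℂ F) (ω : H) :
    ((D.Δl ω).map fun p => epsi p.2 • F p.1).sum = F ω := by
  have := dl_eq D (fun a b => epsi b • F a)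
    (fun x => ⟨fun a b => by simp [h.map_add], fun c a => by simp [h.map_smul, smul_comm c]⟩)
    (fun y => ⟨fun a b => by simp [epsi_lin.map_add, add_smul],
      fun c a => by simp [epsi_lin.map_smul, mul_smul]⟩) ω
  rw [this]
  have h2 : TensorProduct.lift (mkBilin (fun a b => epsi b • F a)
    (fun x => ⟨fun a b => by simp [h.map_add], fun c a => by simp [h.map_smul, smul_comm c]⟩)
    (fun y => ⟨fun a b => by simp [epsi_lin.map_add, add_smul],
      fun c a => by simp [epsi_lin.map_smul, mul_smul]⟩))
    = (h.mk' F) ∘ₗ (TensorProduct.rid ℂ H).toLinearMap ∘ₗ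
      (Coalgebra.counit (R := ℂ) (A := H)).lTensor H := by
    ext a b
    simp [mkBilin, epsi]
  rw [h2]
  simp

lemma epsi_Sinv (D : HopfData H) (ω : H) : epsi (D.Sinv ω) = epsi ω := by
  have := HopfAlgebra.counit_antipode (R := ℂ) (D.Sinv ω)
  rw [D.antipode_Sinv] at this
  exact this.symm

/-- front recursion for the iterated Sweedler decomposition -/
lemma sw_front (D : HopfData H) (n : ℕ) : ∀ (Φ : (Fin (n + 2) → H) → W) (ω : H),
    ((D.sw (n + 1) ω).map Φ).sum
      = ((D.Δl ω).map fun p => ((D.sw n p.2).map fun v => Φ (Fin.cons p.1 v)).sum).sum := by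
  induction n with
  | zero =>
    intro Φ ω
    simp only [HopfData.sw, List.flatMap_cons, List.flatMap_nil, List.append_nil, List.map_map,
      List.map_cons, List.map_nil, List.sum_cons, List.sum_nil, add_zero]
    congr 1
    refine List.map_congr_left fun p _ => ?_
    simp only [Function.comp]
    congr 1
    ext i
    refine Fin.cases ?_ (fun i => ?_) i
    · have : (0 : Fin 2) = Fin.castSucc (0 : Fin 1) := rfl
      rw [this, Fin.snoc_castSucc]; simp
    · have : i.succ = Fin.last 1 := by
        apply Fin.ext
        have := i.isLt
        simp only [Fin.val_succ, Fin.val_last]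
        omega
      rw [Fin.cons_succ, this, Fin.snoc_last]
  | succ n ih =>
    intro Φ ω
    have key : ∀ (m : ℕ) (Φ : (Fin (m + 2) → H) → W) (ω : H),
      ((D.sw (m + 1) ω).map Φ).sum = ((D.sw m ω).map fun v =>
        ((D.Δl (v (Fin.last m))).map fun p =>
          Φ (Fin.snoc (Function.update v (Fin.last m) p.1) p.2)).sum).sum := by
      intro m Φ ω
      conv_lhs => rw [HopfData.sw]
      generalize D.sw m ω = l
      induction l with
      | nil => simp
      | cons a l ih =>
        simp only [List.flatMap_cons, List.map_append, List.sum_append, List.map_cons,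
          List.sum_cons, ih, List.map_map, Function.comp_def]
    rw [key, ih]
    congr 1
    refine List.map_congr_left fun p _ => ?_
    rw [key]
    congr 1
    refine List.map_congr_left fun v _ => ?_
    rw [← Fin.succ_last, Fin.cons_succ]
    congr 1
    refine List.map_congr_left fun q _ => ?_
    rw [← Fin.cons_update, Fin.cons_snoc_eq_snoc_cons]

/-- multilinearity, unbundled -/
def MLin {m : ℕ} (G : (Fin m → H) → W) : Prop :=
  ∀ (v : Fin m → H) (i : Fin m), IsLinearMap ℂ fun h => G (Function.update v i h)

lemma MLin.cons {m : ℕ} {G : (Fin (m + 1) → H) → W} (hG : MLin G) (a : H) :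
    MLin fun v => G (Fin.cons a v) := by
  intro v i
  have := hG (Fin.cons a v) i.succ
  simpa only [Fin.cons_update] using this

lemma MLin.head {m : ℕ} {G : (Fin (m + 1) → H) → W} (hG : MLin G) (v : Fin m → H) :
    IsLinearMap ℂ fun a => G (Fin.cons a v) := by
  have := hG (Fin.cons 0 v) 0
  simpa only [Fin.update_cons_zero] using this

lemma list_sum_lin {α : Type} (l : List α) (F : α → H → W) (h : ∀ a, IsLinearMap ℂ (F a)) :
    IsLinearMap ℂ fun ω => (l.map fun a => F a ω).sum := by
  constructor
  · intro x y; simp only [(h _).map_add, List.sum_map_add]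
  · intro c y; simp only [(h _).map_smul, List.smul_sum, List.map_map, Function.comp_def]

lemma sw_lin (D : HopfData H) (m : ℕ) : ∀ (G : (Fin (m + 1) → H) → W), MLin G →
    IsLinearMap ℂ fun ω => ((D.sw m ω).map G).sum := by
  induction m with
  | zero =>
    intro G hG
    have := hG (fun _ => 0) 0
    simp only [HopfData.sw, List.map_cons, List.map_nil, List.sum_cons, List.sum_nil, add_zero]
    convert this using 3 with ω
    ext i
    have : i = 0 := Fin.fin_one_eq_zero i
    subst this
    simp
  | succ m ih =>
    intro G hG
    simp only [sw_front]
    refine dl_lin D (fun a b => ((D.sw m b).map fun v => G (Fin.cons a v)).sum) ?_ ?_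
    · intro y
      exact list_sum_lin _ (fun v a => G (Fin.cons a v)) fun v => hG.head v
    · intro x
      exact ih _ (hG.cons x)

/-- the counit removes a Sweedler leg -/
lemma sw_counit (D : HopfData H) (m : ℕ) : ∀ (G : (Fin (m + 1) → H) → W), MLin G →
    ∀ (j : Fin (m + 2)) (ω : H),
    ((D.sw (m + 1) ω).map fun v => epsi (v j) • G (j.removeNth v)).sum
      = ((D.sw m ω).map G).sum := by
  induction m with
  | zero =>
    intro G hG j ω
    rw [sw_front]
    have hlin : IsLinearMap ℂ fun ω => G fun _ => ω := by
      have := sw_lin D 0 G hG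
      simpa [HopfData.sw] using this
    simp only [HopfData.sw, List.map_cons, List.map_nil, List.sum_cons, List.sum_nil, add_zero]
    have e1 : ∀ p : H × H, (0 : Fin 2).removeNth (Fin.cons p.1 fun _ => p.2 : Fin 2 → H)
        = fun _ => p.2 := by
      intro p; ext i; have : i = 0 := Fin.fin_one_eq_zero i
      subst this; rfl
    have e2 : ∀ p : H × H, (1 : Fin 2).removeNth (Fin.cons p.1 fun _ => p.2 : Fin 2 → H)
        = fun _ => p.1 := by
      intro p; ext i; have : i = 0 := Fin.fin_one_eq_zero i
      subst this; rfl
    have hj : j = 0 ∨ j = 1 := by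
      have := j.isLt
      rcases (by omega : (j : ℕ) = 0 ∨ (j : ℕ) = 1) with h | h
      · exact Or.inl (Fin.ext h)
      · exact Or.inr (Fin.ext h)
    rcases hj with rfl | rfl
    · rw [← dl_counit_left D _ hlin ω]
      congr 1
    · rw [← dl_counit_right D _ hlin ω]
      congr 1
      refine List.map_congr_left fun p _ => ?_
      rw [← e2 p]; rfl
  | succ m ih =>
    intro G hG j ω
    rw [sw_front]
    refine Fin.cases ?_ (fun j => ?_) j
    · have := dl_counit_left D _ (sw_lin D _ G hG) ω
      rw [← this]
      congr 1
      refine List.map_congr_left fun p _ => ?_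
      simp only [Fin.cons_zero, List.smul_sum, List.map_map]
      rfl
    · rw [sw_front]
      congr 1
      refine List.map_congr_left fun p _ => ?_
      rw [← ih _ (hG.cons p.1) j p.2]
      congr 1
      refine List.map_congr_left fun v _ => ?_
      simp only [Fin.cons_succ]
      congr 2
      ext i
      refine Fin.cases ?_ (fun i => ?_) i
      · simp [Fin.removeNth]
      · simp [Fin.removeNth]

end Sweedler
end Mor

namespace Mor

section Ops
variable {E : Type} [Ring E] [Algebra ℂ E] {n : ℕ}

/-- the cyclic operator as a linear map -/
def tL (D : HopfData H) (act : H → E → E) (n : ℕ) : Raw H E n →ₗ[ℂ] Raw H E n where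
  toFun := tRaw D act
  map_add' f g := by
    funext ω b
    simp only [tRaw, Pi.add_apply, List.sum_map_add]
  map_smul' c f := by
    funext ω b
    simp only [tRaw, Pi.smul_apply, List.smul_sum, List.map_map, Function.comp_def, RingHom.id_apply]

/-- inner cofaces as linear maps -/
def cL (H : Type) {E : Type} [Ring E] (n : ℕ) (i : Fin (n + 1)) : Raw H E n →ₗ[ℂ] Raw H E (n + 1) where
  toFun f := fun ω b => f ω (contract i b)
  map_add' f g := rfl
  map_smul' c f := rfl

/-- cofaces indexed by natural numbers, as linear maps -/
def dN (D : HopfData H) (act : H → E → E) (n : ℕ) (i : ℕ) : Raw H E n →ₗ[ℂ] Raw H E (n + 1) :=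
  if h : i < n + 1 then cL H n ⟨i, h⟩ else tL D act (n + 1) ∘ₗ cL H n 0

/-- the signed cyclic operator -/
def lam (D : HopfData H) (act : H → E → E) (n : ℕ) : Raw H E n →ₗ[ℂ] Raw H E n :=
  ((-1 : ℂ) ^ n) • tL D act n

/-- signed cofaces -/
def eN (D : HopfData H) (act : H → E → E) (n : ℕ) (i : ℕ) : Raw H E n →ₗ[ℂ] Raw H E (n + 1) :=
  ((-1 : ℂ) ^ i) • dN D act n i

/-- the coboundary -/
def bL (D : HopfData H) (act : H → E → E) (n : ℕ) : Raw H E n →ₗ[ℂ] Raw H E (n + 1) :=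
  ∑ i ∈ Finset.range (n + 2), eN D act n i

lemma dRaw_eq (D : HopfData H) (act : H → E → E) (i : Fin (n + 2)) (f : Raw H E n) :
    dRaw D act i f = dN D act n i f := by
  unfold dRaw dN
  split_ifs <;> rfl

lemma bRaw_eq (D : HopfData H) (act : H → E → E) (f : Raw H E n) :
    bRaw D act f = bL D act n f := by
  funext ω b
  simp only [bRaw, bL, LinearMap.sum_apply, Finset.sum_apply, dRaw_eq]
  rw [Finset.sum_range]
  rfl

lemma isCyc_iff (D : HopfData H) (act : H → E → E) (f : Raw H E n) :
    IsCyc D act f ↔ lam D act n f = f := by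
  constructor
  · intro h; funext ω b; exact h ω b
  · intro h ω b; exact congrFun (congrFun h ω) b

/-- cyclic cocycles -/
def Z (D : HopfData H) (act : H → E → E) (n : ℕ) : Submodule ℂ (Raw H E n) where
  carrier := {f | IsCocycle D act f}
  zero_mem' := by
    refine ⟨⟨⟨?_, ?_, ?_, ?_⟩, ?_⟩, ?_, ?_⟩
    · simp
    · simp
    · simp
    · simp
    · intro ω η b; simp
    · rw [isCyc_iff]; simp
    · rw [bRaw_eq]; simp
  add_mem' := by
    rintro f g ⟨⟨⟨a1, a2, a3, a4⟩, a5⟩, a6, a7⟩ ⟨⟨⟨b1, b2, b3, b4⟩, b5⟩, b6, b7⟩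
    refine ⟨⟨⟨?_, ?_, ?_, ?_⟩, ?_⟩, ?_, ?_⟩
    · intro ω η b; simp only [Pi.add_apply, a1, b1]; ring
    · intro ω η b; simp only [Pi.add_apply, a2, b2]; ring
    · intro ω b i x y; simp only [Pi.add_apply, a3, b3]; ring
    · intro ω b i x y; simp only [Pi.add_apply, a4, b4]; ring
    · intro ω η b
      simp only [Pi.add_apply, List.sum_map_add]
      rw [a5, b5]; ring
    · rw [isCyc_iff] at *; rw [map_add, a6, b6]
    · intro ω b
      have ha := a7 ω b
      have hb := b7 ω b
      rw [bRaw_eq] at *; rw [map_add, Pi.add_apply, Pi.add_apply, ha, hb, add_zero]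
  smul_mem' := by
    rintro c f ⟨⟨⟨a1, a2, a3, a4⟩, a5⟩, a6, a7⟩
    refine ⟨⟨⟨?_, ?_, ?_, ?_⟩, ?_⟩, ?_, ?_⟩
    · intro ω η b; simp only [Pi.smul_apply, a1, smul_eq_mul]; ring
    · intro ω η b; simp only [Pi.smul_apply, a2, smul_eq_mul]; ring
    · intro ω b i x y; simp only [Pi.smul_apply, a3, smul_eq_mul]; ring
    · intro ω b i x y; simp only [Pi.smul_apply, a4, smul_eq_mul]; ring
    · intro ω η b
      simp only [Pi.smul_apply, smul_eq_mul, List.sum_map_mul_left]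
      rw [a5]; ring
    · rw [isCyc_iff] at *; rw [map_smul, a6]
    · intro ω b
      have ha := a7 ω b
      rw [bRaw_eq] at *; rw [map_smul, Pi.smul_apply, Pi.smul_apply, ha, smul_zero]

/-- invariant cochains, as a submodule -/
def CI (D : HopfData H) (act : H → E → E) (n : ℕ) : Submodule ℂ (Raw H E n) where
  carrier := {f | InC D act f}
  zero_mem' := by
    refine ⟨⟨?_, ?_, ?_, ?_⟩, ?_⟩
    · simp
    · simp
    · simp
    · simp
    · intro ω η b; simp
  add_mem' := by
    rintro f g ⟨⟨a1, a2, a3, a4⟩, a5⟩ ⟨⟨b1, b2, b3, b4⟩, b5⟩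
    refine ⟨⟨?_, ?_, ?_, ?_⟩, ?_⟩
    · intro ω η b; simp only [Pi.add_apply, a1, b1]; ring
    · intro ω η b; simp only [Pi.add_apply, a2, b2]; ring
    · intro ω b i x y; simp only [Pi.add_apply, a3, b3]; ring
    · intro ω b i x y; simp only [Pi.add_apply, a4, b4]; ring
    · intro ω η b
      simp only [Pi.add_apply, List.sum_map_add]
      rw [a5, b5]; ring
  smul_mem' := by
    rintro c f ⟨⟨a1, a2, a3, a4⟩, a5⟩
    refine ⟨⟨?_, ?_, ?_, ?_⟩, ?_⟩
    · intro ω η b; simp only [Pi.smul_apply, a1, smul_eq_mul]; ring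
    · intro ω η b; simp only [Pi.smul_apply, a2, smul_eq_mul]; ring
    · intro ω b i x y; simp only [Pi.smul_apply, a3, smul_eq_mul]; ring
    · intro ω b i x y; simp only [Pi.smul_apply, a4, smul_eq_mul]; ring
    · intro ω η b
      simp only [Pi.smul_apply, smul_eq_mul, List.sum_map_mul_left]
      rw [a5]; ring

/-- cyclic coboundaries -/
def Bd (D : HopfData H) (act : H → E → E) (n : ℕ) : Submodule ℂ (Raw H E (n + 1)) :=
  (CI D act n ⊓ LinearMap.ker (lam D act n - LinearMap.id)).map (bL D act n)

lemma mem_Bd (D : HopfData H) (act : H → E → E) (f : Raw H E (n + 1)) :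
    f ∈ Bd D act n ↔ ∃ g : Raw H E n, InC D act g ∧ IsCyc D act g ∧ f = bRaw D act g := by
  simp only [Bd, Submodule.mem_map, Submodule.mem_inf, LinearMap.mem_ker, LinearMap.sub_apply,
    sub_eq_zero, LinearMap.id_apply, isCyc_iff, bRaw_eq]
  constructor
  · rintro ⟨g, ⟨h1, h2⟩, h3⟩; exact ⟨g, h1, h2, h3.symm⟩
  · rintro ⟨g, h1, h2, h3⟩; exact ⟨g, ⟨h1, h2⟩, h3.symm⟩

/-- `t d_{i+1} = d_i t` -/
lemma t_c (D : HopfData H) (act : H → E → E) (i : ℕ) (hi : i + 1 < n + 1) (f : Raw H E n) :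
    tL D act (n + 1) (cL H n ⟨i + 1, hi⟩ f) = cL H n ⟨i, by omega⟩ (tL D act n f) := by
  funext ω b
  simp only [tL, cL, LinearMap.coe_mk, AddHom.coe_mk, tRaw]
  congr 1
  refine List.map_congr_left fun p _ => ?_
  congr 1
  ext j
  obtain ⟨j, hj⟩ := j
  rcases j with _ | j
  · have : contract (⟨i, by omega⟩ : Fin (n + 1)) b (Fin.last n) = b (Fin.last (n + 1)) := by
      have h1 : ¬ (n < i) := by omega
      have h2 : ¬ (n = i) := by omega
      simp [contract, h1, h2]
    change contract _ _ 0 = act p.2 (contract _ b (Fin.last n))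
    rw [this]
    simp [contract]
  · change contract _ _ _ = contract (⟨i, by omega⟩ : Fin (n + 1)) b ⟨j, by omega⟩
    have e1 : ∀ (y : E) (m : ℕ) (hm : m + 1 < n + 2),
      (Fin.cons y (fun i : Fin (n + 1) => b i.castSucc) : Fin (n + 2) → E) ⟨m + 1, hm⟩
        = b ⟨m, by omega⟩ := fun y m hm => rfl
    simp only [contract, Fin.castSucc_mk, Fin.succ_mk, e1, add_lt_add_iff_right,
      add_left_inj]

lemma lam_e_succ (D : HopfData H) (act : H → E → E) (i : ℕ) (hi : i < n) (f : Raw H E n) :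
    lam D act (n + 1) (eN D act n (i + 1) f) = eN D act n i (lam D act n f) := by
  simp only [lam, eN, LinearMap.smul_apply, map_smul, dN]
  rw [dif_pos (by omega), dif_pos (by omega : i < n + 1), t_c, smul_smul, smul_smul]
  congr 1
  ring

lemma lam_e_zero (D : HopfData H) (act : H → E → E) (f : Raw H E n) :
    lam D act (n + 1) (eN D act n 0 f) = eN D act n (n + 1) f := by
  simp only [lam, eN, LinearMap.smul_apply, map_smul, dN]
  rw [dif_pos (by omega), dif_neg (by omega), pow_zero, one_smul]
  rfl

end Ops
end Mor

namespace Mor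
section Coassoc
variable {W : Type} [AddCommGroup W] [Module ℂ W]

lemma dl_coassoc (D : HopfData H) (F : H → H → H → W)
    (h1 : ∀ y z, IsLinearMap ℂ fun x => F x y z)
    (h2 : ∀ x z, IsLinearMap ℂ fun y => F x y z)
    (h3 : ∀ x y, IsLinearMap ℂ fun z => F x y z) (ω : H) :
    ((D.Δl ω).map fun p => ((D.Δl p.1).map fun q => F q.1 q.2 p.2).sum).sum
      = ((D.Δl ω).map fun p => ((D.Δl p.2).map fun q => F p.1 q.1 q.2).sum).sum := by
  let T : H →ₗ[ℂ] H ⊗[ℂ] H →ₗ[ℂ] W :=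
    { toFun := fun x => TensorProduct.lift (mkBilin (F x) (h2 x) (h3 x))
      map_add' := fun x y => by
        ext a b
        exact (h1 a b).map_add x y
      map_smul' := fun c x => by
        ext a b
        exact (h1 a b).map_smul c x }
  let Λ : H ⊗[ℂ] (H ⊗[ℂ] H) →ₗ[ℂ] W := TensorProduct.lift T
  have hΛ : ∀ x y z, Λ (x ⊗ₜ (y ⊗ₜ z)) = F x y z := fun x y z => rfl
  have key := congrArg Λ (Coalgebra.coassoc_apply (R := ℂ) ω)
  rw [D.Δl_repr ω] at key
  simp only [map_list_sum, List.map_map, Function.comp_def, LinearMap.rTensor_tmul,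
    LinearMap.lTensor_tmul] at key
  have e1 : ∀ p : H × H, Λ ((TensorProduct.assoc ℂ H H H)
      ((Coalgebra.comul (R := ℂ) p.1) ⊗ₜ[ℂ] p.2)) = ((D.Δl p.1).map fun q => F q.1 q.2 p.2).sum := by
    intro p
    rw [D.Δl_repr p.1]
    generalize D.Δl p.1 = l
    induction l with
    | nil => simp
    | cons a l ih => simp [TensorProduct.add_tmul, ih, hΛ]
  have e2 : ∀ p : H × H, Λ (p.1 ⊗ₜ[ℂ] (Coalgebra.comul (R := ℂ) p.2))
      = ((D.Δl p.2).map fun q => F p.1 q.1 q.2).sum := by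
    intro p
    rw [D.Δl_repr p.2]
    generalize D.Δl p.2 = l
    induction l with
    | nil => simp
    | cons a l ih => simp [TensorProduct.tmul_add, ih, hΛ]
  simp only [e1, e2] at key
  exact key
end Coassoc

section ops2
variable {E : Type} [Ring E] [Algebra ℂ E] {n : ℕ}

lemma IsML.lin {f : Raw H E n} (hf : IsML f) (b : Fin (n + 1) → E) :
    IsLinearMap ℂ fun ω => f ω b :=
  ⟨fun x y => hf.1 x y b, fun c x => hf.2.1 c x b⟩

lemma IsML.slot {f : Raw H E n} (hf : IsML f) (ω : H) (b : Fin (n + 1) → E) (i : Fin (n + 1)) :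
    IsLinearMap ℂ fun y => f ω (Function.update b i y) :=
  ⟨fun x y => hf.2.2.1 ω b i x y, fun c x => hf.2.2.2 ω b i c x⟩

lemma IsML.slot0 {f : Raw H E n} (hf : IsML f) (ω : H) (b : Fin n → E) :
    IsLinearMap ℂ fun y : E => f ω (Fin.cons y b) := by
  have := IsML.slot hf ω (Fin.cons 0 b) 0
  simpa only [Fin.update_cons_zero] using this

lemma lin_listsum {V W : Type} [AddCommGroup V] [Module ℂ V] [AddCommGroup W] [Module ℂ W]
    {F : V → W} (h : IsLinearMap ℂ F) {α : Type} (l : List α) (g : α → V) :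
    F ((l.map g).sum) = (l.map fun a => F (g a)).sum := by
  have := map_list_sum (h.mk' F) (l.map g)
  rw [List.map_map] at this
  exact this

lemma lin_comp {U V W : Type} [AddCommGroup V] [Module ℂ V] [AddCommGroup W] [Module ℂ W]
    [AddCommGroup U] [Module ℂ U]
    {F : V → W} (h : IsLinearMap ℂ F) {G : U → V} (h' : IsLinearMap ℂ G) :
    IsLinearMap ℂ fun x => F (G x) :=
  ⟨fun x y => by rw [h'.map_add, h.map_add], fun c x => by rw [h'.map_smul, h.map_smul]⟩

lemma fn_lin {D : HopfData H} (A : MAlg D E) (x : E) : IsLinearMap ℂ fun ω => A.fn ω x :=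
  ⟨fun a b => by simp [MAlg.fn, RAct.fn], fun a b => by simp [MAlg.fn, RAct.fn]⟩

lemma fn_lin' {D : HopfData H} (A : MAlg D E) (ω : H) : IsLinearMap ℂ fun x => A.fn ω x :=
  ⟨fun a b => by simp [MAlg.fn, RAct.fn], fun a b => by simp [MAlg.fn, RAct.fn]⟩

lemma mulr_lin (y : E) : IsLinearMap ℂ fun x : E => x * y :=
  ⟨fun a b => by simp [add_mul], fun a b => by simp⟩

lemma mull_lin (y : E) : IsLinearMap ℂ fun x : E => y * x :=
  ⟨fun a b => by simp [mul_add], fun a b => by simp⟩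

/-- `t d_{n+1} = d_n t` -/
lemma t_last {D : HopfData H} (A : MAlg D E) (f : Raw H E n) (hf : IsML f) :
    tL D A.fn (n + 1) (tL D A.fn (n + 1) (cL H n 0 f))
      = cL H n (Fin.last n) (tL D A.fn n f) := by
  funext ω b
  simp only [tL, cL, LinearMap.coe_mk, AddHom.coe_mk, tRaw]
  have e1 : ∀ (y z : E), contract (0 : Fin (n + 1)) (Fin.cons y fun i : Fin (n + 1) =>
      (Fin.cons z fun i : Fin (n + 1) => b i.castSucc : Fin (n + 2) → E) i.castSucc)
      = Fin.cons (y * z) fun i : Fin n => b i.castSucc.castSucc := by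
    intro y z
    ext j
    refine Fin.cases ?_ (fun j => ?_) j
    · simp [contract]
    · simp only [contract, Fin.cons_succ, Fin.castSucc_succ]
      simp
  have e2' : ∀ y : E, (Fin.cons y fun i : Fin n => contract (Fin.last n) b i.castSucc :
      Fin (n + 1) → E) = (Fin.cons y fun i : Fin n => b i.castSucc.castSucc : Fin (n + 1) → E) := by
    intro y
    congr 1
    funext i
    simp [contract]
  have e3 : contract (Fin.last n) b (Fin.last n) = b (Fin.last n).castSucc * b (Fin.last (n + 1)) := by
    simp [contract]
  have e4 : ∀ y : E, (Fin.cons y fun i : Fin (n + 1) => b i.castSucc : Fin (n + 2) → E)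
      (Fin.last (n + 1)) = b (Fin.last n).castSucc := by
    intro y; rw [← Fin.succ_last, Fin.cons_succ]
  simp only [e1, e3, e4, e2']
  rw [dl_coassoc D (fun x y z => f x (Fin.cons (A.fn y (b (Fin.last n).castSucc) *
    A.fn z (b (Fin.last (n + 1)))) fun i : Fin n => b i.castSucc.castSucc))]
  · congr 1
    refine List.map_congr_left fun p _ => ?_
    rw [← lin_listsum (IsML.slot0 hf p.1 _)]
    congr 2
    exact (A.act_mul_mul p.2 _ _).symm
  · intro y z; exact IsML.lin hf _
  · intro x z
    exact lin_comp (IsML.slot0 hf x _) (lin_comp (mulr_lin _) (fn_lin A _))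
  · intro x z
    exact lin_comp (IsML.slot0 hf x _) (lin_comp (mull_lin _) (fn_lin A _))

lemma lam_e_last {D : HopfData H} (A : MAlg D E) (f : Raw H E n) (hf : IsML f) :
    lam D A.fn (n + 1) (eN D A.fn n (n + 1) f) = eN D A.fn n n (lam D A.fn n f) := by
  simp only [lam, eN, LinearMap.smul_apply, map_smul, dN]
  rw [dif_neg (by omega), dif_pos (by omega : n < n + 1), LinearMap.comp_apply, t_last A f hf,
    smul_smul, smul_smul]
  congr 1
  ring

/-- `N b' = b N`, on a single cochain -/
lemma N_b' {D : HopfData H} (A : MAlg D E) (g : Raw H E n)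
    (hg : ∀ m ≤ n, IsML (((lam D A.fn n) ^ m) g)) :
    ∑ j ∈ Finset.range (n + 2), ((lam D A.fn (n + 1)) ^ j)
        (∑ i ∈ Finset.range (n + 1), eN D A.fn n i g)
      = bL D A.fn n (∑ m ∈ Finset.range (n + 1), ((lam D A.fn n) ^ m) g) := by
  have h1 : ∀ (j i : ℕ) (g : Raw H E n), i + j ≤ n →
      ((lam D A.fn (n + 1)) ^ j) (eN D A.fn n (i + j) g) = eN D A.fn n i (((lam D A.fn n) ^ j) g) := by
    intro j
    induction j with
    | zero => intro i g _; rfl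
    | succ j ih =>
      intro i g hij
      rw [pow_succ, Module.End.mul_apply, ← add_assoc, lam_e_succ _ _ _ (by omega),
        ih _ _ (by omega), pow_succ, Module.End.mul_apply]
  have h2 : ∀ (j i : ℕ), i ≤ n → j ≤ n → i < j → ((lam D A.fn (n + 1)) ^ (j + 1)) (eN D A.fn n i g)
      = eN D A.fn n (n + 1 + i - j) (((lam D A.fn n) ^ j) g) := by
    intro j i hi hj hij
    obtain ⟨k, rfl⟩ := Nat.exists_eq_add_of_lt hij
    have := h1 i 0 g (by omega)
    rw [zero_add] at this
    rw [show i + k + 1 + 1 = k + 1 + 1 + i by ring, pow_add, Module.End.mul_apply, this,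
      pow_succ, Module.End.mul_apply, lam_e_zero, pow_succ, Module.End.mul_apply,
      lam_e_last A _ (hg i hi)]
    have := h1 k (n - k) ((lam D A.fn n) (((lam D A.fn n) ^ i) g)) (by omega)
    rw [show n - k + k = n by omega] at this
    rw [this, ← Module.End.mul_apply, ← pow_succ, ← Module.End.mul_apply, ← pow_add]
    congr 2
    · omega
    · congr 1; omega
  have h3 : ∀ i ≤ n, ((lam D A.fn (n + 1)) ^ (i + 1)) (eN D A.fn n i g)
      = eN D A.fn n (n + 1) (((lam D A.fn n) ^ i) g) := by
    intro i hi
    have := h1 i 0 g (by omega)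
    rw [zero_add] at this
    rw [add_comm i 1, pow_add, Module.End.mul_apply, this, pow_one, lam_e_zero]
  simp only [bL, LinearMap.sum_apply, map_sum]
  rw [← Finset.sum_product', ← Finset.sum_product']
  refine Finset.sum_nbij' (fun x => if x.1 ≤ x.2 then (x.1, x.2 - x.1) else (x.1 - 1, n + 2 + x.2 - x.1))
    (fun y => if y.1 + y.2 ≤ n then (y.1, y.1 + y.2) else (y.1 + 1, y.1 + y.2 - (n + 1))) ?_ ?_ ?_ ?_ ?_
  · rintro ⟨j, i⟩ h
    simp only [Finset.mem_product, Finset.mem_range] at h ⊢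
    split_ifs <;> simp only <;> omega
  · rintro ⟨j, i⟩ h
    simp only [Finset.mem_product, Finset.mem_range] at h ⊢
    split_ifs <;> simp only <;> omega
  · rintro ⟨j, i⟩ h
    simp only [Finset.mem_product, Finset.mem_range] at h ⊢
    by_cases hc : j ≤ i
    · simp only [if_pos hc]
      rw [if_pos (by omega)]
      ext <;> dsimp only <;> omega
    · simp only [if_neg hc]
      rw [if_neg (by omega)]
      ext <;> dsimp only <;> omega
  · rintro ⟨j, i⟩ h
    simp only [Finset.mem_product, Finset.mem_range] at h ⊢
    by_cases hc : j + i ≤ n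
    · simp only [if_pos hc]
      rw [if_pos (by omega)]
      ext <;> dsimp only <;> omega
    · simp only [if_neg hc]
      rw [if_neg (by omega)]
      ext <;> dsimp only <;> omega
  · rintro ⟨j, i⟩ h
    simp only [Finset.mem_product, Finset.mem_range] at h ⊢
    split_ifs with hc
    · have := h1 j (i - j) g (by omega)
      rwa [Nat.sub_add_cancel hc] at this
    · obtain ⟨k, rfl⟩ : ∃ k, j = k + 1 := ⟨j - 1, by omega⟩
      rcases (by omega : i = k ∨ i < k) with h' | h'
      · subst h'
        rw [h3 i (by omega)]
        simp only [Nat.add_sub_cancel]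
        congr 2
        omega
      · rw [h2 k i (by omega) (by omega) h']
        simp only [Nat.add_sub_cancel]
        congr 2
        omega
end ops2
end Mor

namespace Mor
section ins
variable {E : Type} [Ring E] [Algebra ℂ E] {n : ℕ}

/-- insert `x` in slot `j` -/
def ins (x : E) (j : Fin (n + 2)) (F : Raw H E (n + 1)) : Raw H E n :=
  fun ω c => F ω (Fin.insertNth j x c)

lemma cons_ins (x y : E) (j : Fin (n + 1)) (c : Fin (n + 1) → E) :
    (Fin.cons y (fun i : Fin (n + 1) => (Fin.insertNth j.castSucc x c : Fin (n + 2) → E) i.castSucc) :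
        Fin (n + 2) → E)
      = Fin.insertNth j.succ x (Fin.cons y (fun i : Fin n => c i.castSucc) : Fin (n + 1) → E) := by
  rw [Fin.eq_insertNth_iff]
  constructor
  · rw [Fin.cons_succ, Fin.insertNth_apply_same]
  · ext i
    refine Fin.cases ?_ (fun i => ?_) i
    · simp [Fin.removeNth]
    · obtain ⟨m, rfl⟩ : ∃ m, n = m + 1 := ⟨n - 1, by have := i.2; omega⟩
      simp only [Fin.removeNth, Fin.succ_succAbove_succ, Fin.cons_succ]
      rw [← Fin.castSucc_succAbove_castSucc, Fin.insertNth_apply_succAbove]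

lemma ins_last (x : E) (j : Fin (n + 1)) (c : Fin (n + 1) → E) :
    (Fin.insertNth j.castSucc x c : Fin (n + 2) → E) (Fin.last (n + 1)) = c (Fin.last n) := by
  have : Fin.last (n + 1) = j.castSucc.succAbove (Fin.last n) := by
    rw [Fin.succAbove_of_le_castSucc, Fin.succ_last]
    exact Fin.castSucc_le_castSucc_iff.2 (Fin.le_last j)
  rw [this, Fin.insertNth_apply_succAbove]

lemma t_ins (D : HopfData H) (act : H → E → E) (x : E) (j : Fin (n + 1)) (F : Raw H E (n + 1)) :
    tL D act n (ins x j.succ F) = ins x j.castSucc (tL D act (n + 1) F) := by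
  funext ω c
  simp only [tL, LinearMap.coe_mk, AddHom.coe_mk, tRaw, ins, cons_ins, ins_last]

lemma lam_ins (D : HopfData H) (act : H → E → E) (x : E) (j : Fin (n + 1)) (F : Raw H E (n + 1))
    (hF : lam D act (n + 1) F = F) :
    lam D act n (ins x j.succ F) = - ins x j.castSucc F := by
  conv_rhs => rw [← hF]
  simp only [lam, LinearMap.smul_apply, t_ins]
  funext ω c
  simp only [ins, Pi.smul_apply, Pi.neg_apply, smul_eq_mul]
  ring

lemma lam_ins_pow (D : HopfData H) (act : H → E → E) (x : E) (F : Raw H E (n + 1))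
    (hF : lam D act (n + 1) F = F) (m : ℕ) (hm : m ≤ n + 1) :
    ((lam D act n) ^ m) (ins x (Fin.last (n + 1)) F)
      = ((-1 : ℂ) ^ m) • ins x ⟨n + 1 - m, by omega⟩ F := by
  induction m with
  | zero => simp; rfl
  | succ m ih =>
    rw [pow_succ', Module.End.mul_apply, ih (by omega), map_smul]
    have := lam_ins D act x ⟨n + 1 - (m + 1), by omega⟩ F hF
    have e : (⟨n + 1 - (m + 1), by omega⟩ : Fin (n + 1)).succ = ⟨n + 1 - m, by omega⟩ := by
      ext; simp; omega
    rw [e] at this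
    rw [this, pow_succ]
    simp

lemma ins_last_eq {D : HopfData H} (A : MAlg D E) (x : E) (hx : ∀ ω, A.fn ω x = epsi ω • x)
    (F : Raw H E (n + 1)) (hm : IsML F)
    (hF : lam D A.fn (n + 1) F = F) :
    ins x (Fin.last (n + 1)) F = ((-1 : ℂ) ^ (n + 1)) • ins x 0 F := by
  conv_lhs => rw [← hF]
  simp only [lam, LinearMap.smul_apply]
  funext ω c
  simp only [ins, Pi.smul_apply, tL, LinearMap.coe_mk, AddHom.coe_mk, tRaw,
    Fin.insertNth_apply_same, hx]
  congr 1
  rw [← dl_counit_right D (fun ω => F ω (Fin.insertNth 0 x c)) (IsML.lin hm _)]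
  congr 1
  refine List.map_congr_left fun p _ => ?_
  have h := (IsML.slot0 hm p.1 fun i : Fin (n + 1) =>
    (Fin.insertNth (Fin.last (n + 1)) x c : Fin (n + 2) → E) i.castSucc).map_smul (epsi p.2) x
  rw [h]
  congr 2
  rw [Fin.insertNth_zero']
  rw [Fin.insertNth_last']
  congr 1
  funext i
  rw [Fin.snoc_castSucc]

lemma ins_ML (x : E) (j : Fin (n + 2)) (F : Raw H E (n + 1)) (hm : IsML F) :
    IsML (ins x j F) := by
  refine ⟨fun ω η b => hm.1 _ _ _, fun c ω b => hm.2.1 _ _ _, fun ω b i y z => ?_,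
    fun ω b i c y => ?_⟩
  · simp only [ins, Fin.insertNth_update]; exact hm.2.2.1 _ _ _ _ _
  · simp only [ins, Fin.insertNth_update]; exact hm.2.2.2 _ _ _ _ _

lemma inv_MLin {D : HopfData H} (A : MAlg D E) (F : Raw H E n) (hm : IsML F) (η : H)
    (b : Fin (n + 1) → E) :
    MLin fun v : Fin (n + 3) → H =>
      F (D.Sinv (v 0) * η * v 1) fun i => A.fn (v i.succ.succ) (b i) := by
  intro v i
  refine Fin.cases ?_ (fun i => ?_) i
  · have h : ∀ y : H, (fun i => A.fn ((Function.update v 0 y) i.succ.succ) (b i))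
        = fun i : Fin (n + 1) => A.fn (v i.succ.succ) (b i) := by
      intro y; funext i; rw [Function.update_of_ne (Fin.succ_ne_zero _)]
    have h' : ∀ y : H, (Function.update v 0 y) 1 = v 1 := fun y =>
      Function.update_of_ne (by simp) _ _
    simp only [h, h', Function.update_self]
    refine lin_comp (IsML.lin hm _) ⟨fun a b => ?_, fun c a => ?_⟩
    · simp [add_mul]
    · simp
  · have h' : ∀ y : H, (Function.update v i.succ y) 0 = v 0 := fun y =>
      Function.update_of_ne (Fin.succ_ne_zero _).symm _ _
    simp only [h']
    refine Fin.cases ?_ (fun i => ?_) i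
    · have h : ∀ y : H, (fun i => A.fn ((Function.update v (Fin.succ 0) y) i.succ.succ) (b i))
        = fun i : Fin (n + 1) => A.fn (v i.succ.succ) (b i) := by
        intro y; funext i; rw [Function.update_of_ne]
        rw [Ne, Fin.succ_inj]; exact Fin.succ_ne_zero _
      simp only [h]
      refine lin_comp (IsML.lin hm _) ⟨fun a b => ?_, fun c a => ?_⟩
      · simp [mul_add]
      · simp
    · have h : ∀ y : H, (fun k => A.fn ((Function.update v i.succ.succ y) k.succ.succ) (b k))
        = Function.update (fun k : Fin (n + 1) => A.fn (v k.succ.succ) (b k)) i (A.fn y (b i)) := by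
        intro y; funext k
        by_cases hk : k = i
        · subst hk; simp
        · rw [Function.update_of_ne hk, Function.update_of_ne]
          rwa [Ne, Fin.succ_inj, Fin.succ_inj]
      have h' : ∀ y : H, (Function.update v i.succ.succ y) 1 = v 1 := fun y =>
        Function.update_of_ne (by 
          intro h; rw [← Fin.succ_zero_eq_one, Fin.succ_inj] at h
          exact Fin.succ_ne_zero _ h.symm) _ _
      simp only [h, h']
      exact lin_comp (IsML.slot hm _ _ i) (fn_lin A (b i))

lemma ins_InC {D : HopfData H} (A : MAlg D E) (x : E) (hx : ∀ ω, A.fn ω x = epsi ω • x)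
    (j : Fin (n + 2)) (F : Raw H E (n + 1)) (hF : InC D A.fn F) :
    InC D A.fn (ins x j F) := by
  refine ⟨ins_ML x j F hF.1, fun ω η b => ?_⟩
  have h := hF.2 ω η (Fin.insertNth j x b)
  rw [show (ins x j F η b) = F η (Fin.insertNth j x b) from rfl, ← h]
  rw [← sw_counit D (n + 2) _ (inv_MLin A _ (ins_ML x j F hF.1) η b) j.succ.succ]
  congr 1
  refine List.map_congr_left fun v _ => ?_
  have e0 : (j.succ.succ.removeNth v) 0 = v 0 := by simp [Fin.removeNth]
  have e1 : (j.succ.succ.removeNth v) 1 = v 1 := by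
    simp only [Fin.removeNth]
    rw [← Fin.succ_zero_eq_one, Fin.succ_succAbove_succ, Fin.succ_succAbove_zero]
    rfl
  have e2 : ∀ i : Fin (n + 1), (j.succ.succ.removeNth v) i.succ.succ
      = v (j.succAbove i).succ.succ := by
    intro i
    simp only [Fin.removeNth, Fin.succ_succAbove_succ]
  simp only [e0, e1, e2, ins]
  have e3 : (fun i => A.fn (v i.succ.succ) ((Fin.insertNth j x b : Fin (n + 2) → E) i))
     = Function.update (Fin.insertNth j x fun i => A.fn (v (j.succAbove i).succ.succ) (b i) :
         Fin (n + 2) → E) j (epsi (v j.succ.succ) • x) := by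
    funext i
    rcases Fin.eq_self_or_eq_succAbove j i with rfl | ⟨k, rfl⟩
    · simp [hx]
    · simp
  rw [e3, hF.1.2.2.2]
  simp
end ins
end Mor

namespace Mor
section slots
variable {E : Type} [Ring E] [Algebra ℂ E] {n : ℕ}

/-- apply `θ` in slot `j` -/
def sl (θ : E → E) (j : Fin (n + 1)) (F : Raw H E n) : Raw H E n :=
  fun ω c => F ω (Function.update c j (θ (c j)))

lemma t_sl_succ (D : HopfData H) (act : H → E → E) (θ : E → E) (j : Fin n) (F : Raw H E n) :
    tL D act n (sl θ j.succ F) = sl θ j.castSucc (tL D act n F) := by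
  funext ω c
  simp only [tL, LinearMap.coe_mk, AddHom.coe_mk, tRaw, sl, ← Fin.cons_update, Fin.cons_succ]
  congr 1
  refine List.map_congr_left fun p _ => ?_
  rw [Function.update_of_ne (Fin.castSucc_lt_last j).ne']
  congr 2
  funext i
  by_cases h : i = j
  · subst h; simp
  · rw [Function.update_of_ne h, Function.update_of_ne]
    simpa using h

lemma t_sl_zero (D : HopfData H) (act : H → E → E) (θ : E → E)
    (hθ : ∀ ω x, act ω (θ x) = θ (act ω x)) (F : Raw H E n) :
    tL D act n (sl θ 0 F) = sl θ (Fin.last n) (tL D act n F) := by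
  funext ω c
  simp only [tL, LinearMap.coe_mk, AddHom.coe_mk, tRaw, sl, Fin.update_cons_zero, Fin.cons_zero,
    Function.update_self, hθ]
  congr 1
  refine List.map_congr_left fun p _ => ?_
  congr 2
  funext i
  rw [Function.update_of_ne (Fin.castSucc_lt_last i).ne]

lemma sl_smul (θ : E → E) (j : Fin (n + 1)) (F : Raw H E n) (c : ℂ) :
    sl θ j (c • F) = c • sl θ j F := rfl

lemma lam_sl_succ (D : HopfData H) (act : H → E → E) (θ : E → E) (j : Fin n) (F : Raw H E n)
    (hF : lam D act n F = F) :
    lam D act n (sl θ j.succ F) = sl θ j.castSucc F := by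
  conv_rhs => rw [← hF]
  simp only [lam, LinearMap.smul_apply, t_sl_succ, sl_smul]

lemma lam_sl_zero (D : HopfData H) (act : H → E → E) (θ : E → E)
    (hθ : ∀ ω x, act ω (θ x) = θ (act ω x)) (F : Raw H E n)
    (hF : lam D act n F = F) :
    lam D act n (sl θ 0 F) = sl θ (Fin.last n) F := by
  conv_rhs => rw [← hF]
  simp only [lam, LinearMap.smul_apply, t_sl_zero D act θ hθ, sl_smul]

lemma lam_sl_pow (D : HopfData H) (act : H → E → E) (θ : E → E) (F : Raw H E n)
    (hF : lam D act n F = F) (m : ℕ) (hm : m ≤ n) :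
    ((lam D act n) ^ m) (sl θ (Fin.last n) F) = sl θ ⟨n - m, by omega⟩ F := by
  induction m with
  | zero => rfl
  | succ m ih =>
    rw [pow_succ', Module.End.mul_apply, ih (by omega)]
    have := lam_sl_succ D act θ ⟨n - (m + 1), by omega⟩ F hF
    have e : (⟨n - (m + 1), by omega⟩ : Fin n).succ = ⟨n - m, by omega⟩ := by
      ext; simp; omega
    rw [e] at this
    exact this

/-- sum over all slots -/
def Lop (θ : E → E) (F : Raw H E n) : Raw H E n := ∑ j, sl θ j F

lemma N_sl_last (D : HopfData H) (act : H → E → E) (θ : E → E) (F : Raw H E n)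
    (hF : lam D act n F = F) :
    ∑ m ∈ Finset.range (n + 1), ((lam D act n) ^ m) (sl θ (Fin.last n) F) = Lop θ F := by
  rw [← Finset.sum_range_reflect, Finset.sum_range, Lop]
  refine Finset.sum_congr rfl fun j _ => ?_
  rw [lam_sl_pow D act θ F hF _ (by omega)]
  congr 1
  ext
  simp
  omega

lemma N_sl_zero (D : HopfData H) (act : H → E → E) (θ : E → E)
    (hθ : ∀ ω x, act ω (θ x) = θ (act ω x)) (F : Raw H E n)
    (hF : lam D act n F = F) :
    ∑ m ∈ Finset.range (n + 1), ((lam D act n) ^ m) (sl θ 0 F) = Lop θ F := by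
  rw [← N_sl_last D act θ F hF, ← lam_sl_zero D act θ hθ F hF]
  simp only [← Module.End.mul_apply, ← pow_succ]
  rw [Finset.sum_range_succ', Finset.sum_range_succ]
  congr 1
  rw [pow_succ, Module.End.mul_apply, lam_sl_zero D act θ hθ F hF, lam_sl_pow D act θ F hF n le_rfl]
  simp

lemma fn_mul_inv_left {D : HopfData H} (A : MAlg D E) (x : E) (hx : ∀ ω, A.fn ω x = epsi ω • x)
    (ω : H) (c : E) : A.fn ω (x * c) = x * A.fn ω c := by
  have h := A.act_mul_mul ω x c
  change A.fn ω (x * c) = ((D.Δl ω).map fun p => A.fn p.1 x * A.fn p.2 c).sum at h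
  rw [h]
  simp only [hx]
  have := dl_counit_left D (fun ω => x * A.fn ω c) (lin_comp (mull_lin x) (fn_lin A c)) ω
  rw [← this]
  simp

lemma fn_mul_inv_right {D : HopfData H} (A : MAlg D E) (x : E) (hx : ∀ ω, A.fn ω x = epsi ω • x)
    (ω : H) (c : E) : A.fn ω (c * x) = A.fn ω c * x := by
  have h := A.act_mul_mul ω c x
  change A.fn ω (c * x) = ((D.Δl ω).map fun p => A.fn p.1 c * A.fn p.2 x).sum at h
  rw [h]
  simp only [hx]
  have := dl_counit_right D (fun ω => A.fn ω c * x) (lin_comp (mulr_lin x) (fn_lin A c)) ω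
  rw [← this]
  simp

lemma contract_zero_cons (x : E) (c : Fin (n + 1) → E) :
    contract (0 : Fin (n + 1)) (Fin.cons x c : Fin (n + 2) → E)
      = Function.update c 0 (x * c 0) := by
  funext j
  refine Fin.cases ?_ (fun j => ?_) j
  · simp [contract]
  · simp [contract]

lemma contract_succ_cons (x : E) (c : Fin (n + 2) → E) (k : Fin (n + 1)) :
    contract k.succ (Fin.cons x c : Fin (n + 3) → E)
      = (Fin.cons x (contract k c) : Fin (n + 2) → E) := by
  funext j
  refine Fin.cases ?_ (fun j => ?_) j
  · simp [contract]
  · simp [contract]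

lemma bprime_ins {D : HopfData H} (A : MAlg D E) (x : E) (hx : ∀ ω, A.fn ω x = epsi ω • x)
    (F : Raw H E (n + 1)) (hF : lam D A.fn (n + 1) F = F) (hb : bL D A.fn (n + 1) F = 0) :
    ∑ i ∈ Finset.range (n + 1), eN D A.fn n i (ins x 0 F)
      = sl (fun c => x * c) 0 F - sl (fun c => c * x) (Fin.last (n + 1)) F := by
  funext ω c
  have h := congrFun (congrFun hb ω) (Fin.cons x c)
  simp only [bL, LinearMap.sum_apply, Finset.sum_apply] at h
  rw [Finset.sum_range_succ, Finset.sum_range_succ'] at h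
  have h0 : eN D A.fn (n + 1) 0 F ω (Fin.cons x c) = sl (fun c => x * c) 0 F ω c := by
    simp only [eN, dN, pow_zero, one_smul]
    rw [dif_pos (by omega)]
    change F ω (contract 0 (Fin.cons x c : Fin (n + 3) → E)) = _
    rw [contract_zero_cons]; rfl
  have h1 : ∀ k ∈ Finset.range (n + 1), eN D A.fn (n + 1) (k + 1) F ω (Fin.cons x c)
      = - eN D A.fn n k (ins x 0 F) ω c := by
    intro k hk
    have hk := Finset.mem_range.1 hk
    simp only [eN, dN]
    rw [dif_pos (by omega), dif_pos hk]
    simp only [LinearMap.smul_apply, Pi.smul_apply]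
    change _ • F ω (contract (⟨k, hk⟩ : Fin (n + 1)).succ (Fin.cons x c : Fin (n + 3) → E))
      = - ( _ • F ω _)
    rw [contract_succ_cons, Fin.insertNth_zero']
    simp only [smul_eq_mul]; ring
  have h2 : eN D A.fn (n + 1) (n + 1 + 1) F ω (Fin.cons x c)
      = - sl (fun c => c * x) (Fin.last (n + 1)) F ω c := by
    conv_rhs => rw [← hF]
    simp only [eN, dN]
    rw [dif_neg (by omega)]
    simp only [LinearMap.smul_apply, Pi.smul_apply, lam, sl, LinearMap.comp_apply]
    rw [pow_succ, smul_eq_mul, smul_eq_mul, mul_neg, mul_one, neg_mul]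
    congr 2
    simp only [tL, cL, LinearMap.coe_mk, AddHom.coe_mk, tRaw, Function.update_self,
      fn_mul_inv_right A x hx]
    congr 1
    refine List.map_congr_left fun p _ => ?_
    rw [contract_zero_cons]
    congr 1
    have : (Fin.cons x c : Fin (n + 3) → E) (Fin.last (n + 1 + 1)) = c (Fin.last (n + 1)) := by
      rw [← Fin.succ_last, Fin.cons_succ]
    rw [this]
    funext j
    refine Fin.cases ?_ (fun j => ?_) j
    · simp
    · rw [Function.update_of_ne (Fin.succ_ne_zero _), Fin.cons_succ, ← Fin.succ_castSucc,
        Fin.cons_succ, Function.update_of_ne (Fin.castSucc_lt_last _).ne]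
  rw [Finset.sum_congr rfl h1, h0, h2, Finset.sum_neg_distrib] at h
  simp only [Finset.sum_apply, Pi.sub_apply]
  have h' : (0 : Raw H E (n + 1 + 1)) ω (Fin.cons x c) = 0 := rfl
  rw [h'] at h
  linear_combination -h

lemma sl_sub (θ θ' : E → E) (j : Fin (n + 1)) (F : Raw H E n) (hF : IsML F) :
    sl (fun c => θ c - θ' c) j F = sl θ j F - sl θ' j F := by
  funext ω c
  exact (IsML.slot hF ω c j).map_sub _ _

/-- inner derivations act trivially on cyclic cohomology -/
theorem L_mem_Bd {D : HopfData H} (A : MAlg D E) (x : E) (hx : ∀ ω, A.fn ω x = epsi ω • x)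
    (F : Raw H E (n + 1)) (hF : F ∈ Z D A.fn (n + 1)) :
    Lop (fun c => x * c - c * x) F ∈ Bd D A.fn n := by
  obtain ⟨hC, hcy, hb⟩ := hF
  rw [isCyc_iff] at hcy
  have hb' : bL D A.fn (n + 1) F = 0 := by
    rw [← bRaw_eq]; funext ω b; exact hb ω b
  have hp : ∀ m ≤ n + 1, ((lam D A.fn n) ^ m) (ins x 0 F)
      = ((-1 : ℂ) ^ (n + 1) * (-1 : ℂ) ^ m) • ins x ⟨n + 1 - m, by omega⟩ F := by
    intro m hm
    have h1 := ins_last_eq A x hx F hC.1 hcy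
    have h2 : ins x 0 F = ((-1 : ℂ) ^ (n + 1)) • ins x (Fin.last (n + 1)) F := by
      rw [h1, smul_smul, ← mul_pow]; simp
    rw [h2, map_smul, lam_ins_pow D A.fn x F hcy m hm, smul_smul]
  have hCI : ∀ m ≤ n + 1, ((lam D A.fn n) ^ m) (ins x 0 F) ∈ CI D A.fn n := by
    intro m hm
    rw [hp m hm]
    exact Submodule.smul_mem _ _ (ins_InC A x hx _ F hC)
  have hN := N_b' A (ins x 0 F) (fun m hm => (hCI m (by omega)).1)
  rw [bprime_ins A x hx F hcy hb'] at hN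
  simp only [map_sub, Finset.sum_sub_distrib] at hN
  rw [N_sl_zero D A.fn _ (fun ω c => fn_mul_inv_left A x hx ω c) F hcy,
    N_sl_last D A.fn _ F hcy] at hN
  have hL : Lop (fun c => x * c - c * x) F
      = Lop (fun c => x * c) F - Lop (fun c => c * x) F := by
    simp only [Lop, ← Finset.sum_sub_distrib]
    exact Finset.sum_congr rfl fun j _ => sl_sub _ _ j F hC.1
  rw [hL, hN]
  refine Submodule.mem_map_of_mem ⟨?_, ?_⟩
  · exact Submodule.sum_mem _ fun m hm => hCI m (by have := Finset.mem_range.1 hm; omega)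
  · rw [SetLike.mem_coe, LinearMap.mem_ker, LinearMap.sub_apply, sub_eq_zero, LinearMap.id_apply, map_sum]
    simp only [← Module.End.mul_apply, ← pow_succ']
    rw [Finset.sum_range_succ, Finset.sum_range_succ', add_comm]
    rw [add_comm]
    congr 1
    rw [hp _ le_rfl, ← mul_pow]
    simp
end slots
end Mor

namespace Mor
section pullback
variable {E E' : Type} [Ring E] [Algebra ℂ E] [Ring E'] [Algebra ℂ E'] {n : ℕ}

/-- pull back along a linear map -/
def pb (φ : E' →ₗ[ℂ] E) (n : ℕ) : Raw H E n →ₗ[ℂ] Raw H E' n where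
  toFun F := fun ω c => F ω fun i => φ (c i)
  map_add' f g := rfl
  map_smul' c f := rfl

lemma pb_apply (φ : E' →ₗ[ℂ] E) (F : Raw H E n) (ω : H) (c : Fin (n + 1) → E') :
    pb φ n F ω c = F ω fun i => φ (c i) := rfl

lemma comp_update' (φ : E' →ₗ[ℂ] E) (c : Fin (n + 1) → E') (i : Fin (n + 1)) (y : E') :
    (fun k => φ (Function.update c i y k)) = Function.update (fun k => φ (c k)) i (φ y) := by
  funext k
  by_cases h : k = i
  · subst h; simp
  · simp [h]

lemma pb_InC (D : HopfData H) {act : H → E → E} {act' : H → E' → E'} (φ : E' →ₗ[ℂ] E)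
    (he : ∀ ω c, φ (act' ω c) = act ω (φ c)) (F : Raw H E n) (hF : InC D act F) :
    InC D act' (pb φ n F) := by
  refine ⟨⟨fun ω η b => hF.1.1 _ _ _, fun c ω b => hF.1.2.1 _ _ _, fun ω b i y z => ?_,
    fun ω b i c y => ?_⟩, fun ω η b => ?_⟩
  · simp only [pb_apply, comp_update', map_add]; exact hF.1.2.2.1 _ _ _ _ _
  · simp only [pb_apply, comp_update', map_smul]; exact hF.1.2.2.2 _ _ _ _ _
  · simp only [pb_apply, he]; exact hF.2 ω η _

lemma comp_cons' (φ : E' →ₗ[ℂ] E) (c : Fin n → E') (y : E') :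
    (fun k => φ ((Fin.cons y c : Fin (n + 1) → E') k)) = (Fin.cons (φ y) fun k => φ (c k) : Fin (n + 1) → E) := by
  funext k
  refine Fin.cases ?_ (fun k => ?_) k <;> simp

lemma pb_tL (D : HopfData H) {act : H → E → E} {act' : H → E' → E'} (φ : E' →ₗ[ℂ] E)
    (he : ∀ ω c, φ (act' ω c) = act ω (φ c)) (F : Raw H E n) :
    tL D act' n (pb φ n F) = pb φ n (tL D act n F) := by
  funext ω c
  simp only [tL, LinearMap.coe_mk, AddHom.coe_mk, tRaw, pb_apply, comp_cons', he]

lemma pb_lam (D : HopfData H) {act : H → E → E} {act' : H → E' → E'} (φ : E' →ₗ[ℂ] E)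
    (he : ∀ ω c, φ (act' ω c) = act ω (φ c)) (F : Raw H E n) :
    lam D act' n (pb φ n F) = pb φ n (lam D act n F) := by
  simp only [lam, LinearMap.smul_apply, map_smul, pb_tL D φ he]

lemma pb_cL (φ : E' →ₗ[ℂ] E)
    (hm : ∀ a b, φ (a * b) = φ a * φ b) (F : Raw H E n) (i : Fin (n + 1)) :
    cL H n i (pb φ n F) = pb φ (n + 1) (cL H n i F) := by
  funext ω c
  simp only [cL, LinearMap.coe_mk, AddHom.coe_mk, pb_apply]
  congr 1
  funext j
  simp only [contract]
  split_ifs <;> simp [hm]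

lemma pb_bL (D : HopfData H) {act : H → E → E} {act' : H → E' → E'} (φ : E' →ₗ[ℂ] E)
    (hm : ∀ a b, φ (a * b) = φ a * φ b)
    (he : ∀ ω c, φ (act' ω c) = act ω (φ c)) (F : Raw H E n) :
    bL D act' n (pb φ n F) = pb φ (n + 1) (bL D act n F) := by
  simp only [bL, LinearMap.sum_apply, map_sum]
  refine Finset.sum_congr rfl fun i _ => ?_
  simp only [eN, dN, LinearMap.smul_apply, map_smul]
  split_ifs
  · rw [pb_cL φ hm]
  · simp only [LinearMap.comp_apply]
    rw [pb_cL φ hm, pb_tL D φ he]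

lemma mem_Z (D : HopfData H) {act : H → E → E} (F : Raw H E n) :
    F ∈ Z D act n ↔ InC D act F ∧ lam D act n F = F ∧ bL D act n F = 0 := by
  change InC D act F ∧ IsCyc D act F ∧ _ ↔ _
  rw [isCyc_iff, bRaw_eq]
  refine and_congr_right fun _ => and_congr_right fun _ => ?_
  constructor
  · intro h; funext ω b; exact h ω b
  · intro h ω b; rw [h]; rfl

lemma pb_Z (D : HopfData H) {act : H → E → E} {act' : H → E' → E'} (φ : E' →ₗ[ℂ] E)
    (hm : ∀ a b, φ (a * b) = φ a * φ b)
    (he : ∀ ω c, φ (act' ω c) = act ω (φ c)) (F : Raw H E n) (hF : F ∈ Z D act n) :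
    pb φ n F ∈ Z D act' n := by
  rw [mem_Z] at *
  refine ⟨pb_InC D φ he F hF.1, ?_, ?_⟩
  · rw [pb_lam D φ he, hF.2.1]
  · rw [pb_bL D φ hm he, hF.2.2, map_zero]

lemma pb_Bd (D : HopfData H) {act : H → E → E} {act' : H → E' → E'} (φ : E' →ₗ[ℂ] E)
    (hm : ∀ a b, φ (a * b) = φ a * φ b)
    (he : ∀ ω c, φ (act' ω c) = act ω (φ c)) (F : Raw H E (n + 1)) (hF : F ∈ Bd D act n) :
    pb φ (n + 1) F ∈ Bd D act' n := by
  rw [mem_Bd] at *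
  obtain ⟨g, h1, h2, rfl⟩ := hF
  refine ⟨pb φ n g, pb_InC D φ he g h1, ?_, ?_⟩
  · rw [isCyc_iff] at *; rw [pb_lam D φ he, h2]
  · rw [bRaw_eq, bRaw_eq, pb_bL D φ hm he]
end pullback

section vandermonde
variable {V : Type} [AddCommGroup V] [Module ℂ V]

lemma integrate_mem (S : Submodule ℂ V) {ε : Type} (s : Finset ε) (d : ε → ℕ) (w : ε → V)
    (h : ∀ t : ℂ, ∑ e ∈ s, (t ^ d e * (d e : ℂ)) • w e ∈ S) :
    ∑ e ∈ s, (1 : ℂ) ^ d e • w e - ∑ e ∈ s, (0 : ℂ) ^ d e • w e ∈ S := by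
  rw [← Submodule.Quotient.mk_eq_zero, ← Module.forall_dual_apply_eq_zero_iff ℂ]
  intro φ
  let ψ : V →ₗ[ℂ] ℂ := φ ∘ₗ S.mkQ
  let p : Polynomial ℂ := ∑ e ∈ s, Polynomial.C (ψ (w e)) * Polynomial.X ^ d e
  have hp : ∀ t, p.eval t = ψ (∑ e ∈ s, t ^ d e • w e) := by
    intro t
    simp only [p, Polynomial.eval_finsetSum, map_sum, map_smul, Polynomial.eval_mul,
      Polynomial.eval_C, Polynomial.eval_pow, Polynomial.eval_X, smul_eq_mul, mul_comm]
  have hd : Polynomial.X * Polynomial.derivative p = 0 := by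
    refine Polynomial.funext fun t => ?_
    have h1 : ψ (∑ e ∈ s, (t ^ d e * (d e : ℂ)) • w e) = 0 := by
      have := (Submodule.Quotient.mk_eq_zero S).2 (h t)
      change φ (Submodule.Quotient.mk _) = 0
      rw [this, map_zero]
    rw [Polynomial.eval_zero, ← h1]
    simp only [p, Polynomial.eval_mul, Polynomial.eval_finsetSum,
      map_sum, map_smul, Polynomial.derivative_C_mul, Polynomial.derivative_X_pow,
      Polynomial.eval_C, Polynomial.eval_pow, Polynomial.eval_X, smul_eq_mul, Finset.mul_sum]
    refine Finset.sum_congr rfl fun e _ => ?_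
    rcases d e with _ | k
    · simp
    · simp; ring
  have hd' : Polynomial.derivative p = 0 := by
    rcases mul_eq_zero.1 hd with h | h
    · exact absurd h Polynomial.X_ne_zero
    · exact h
  have hc := Polynomial.eq_C_of_natDegree_eq_zero (Polynomial.derivative_eq_zero.1 hd')
  change ψ _ = 0
  rw [map_sub, ← hp, ← hp, hc]
  simp
end vandermonde

section expo
variable {E : Type} [Ring E] [Algebra ℂ E] {n : ℕ}

/-- conjugation by `1 + t x` -/
def R (x : E) (t : ℂ) : E →ₗ[ℂ] E where
  toFun c := c + t • (x * c - c * x) - t ^ 2 • (x * c * x)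
  map_add' a b := by
    simp only [mul_add, add_mul, smul_add, smul_sub]; abel
  map_smul' r a := by
    simp only [mul_smul_comm, smul_mul_assoc, RingHom.id_apply, smul_add, smul_sub, smul_comm r]

lemma R_apply (x : E) (t : ℂ) (c : E) :
    R x t c = c + t • (x * c - c * x) - t ^ 2 • (x * c * x) := rfl

lemma R_conj (x : E) (t : ℂ) (c : E) : R x t c = (1 + t • x) * c * (1 - t • x) := by
  rw [R_apply]
  simp only [mul_sub, add_mul, one_mul, mul_one, smul_mul_assoc, mul_smul_comm, smul_sub, smul_add,
    smul_smul, sq]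
  abel

lemma R_mul (x : E) (hx : x * x = 0) (t : ℂ) (a b : E) : R x t (a * b) = R x t a * R x t b := by
  have : (1 - t • x) * (1 + t • x) = 1 := by
    simp [mul_add, sub_mul, hx]
  rw [R_conj, R_conj, R_conj]
  calc _ = (1 + t • x) * a * 1 * b * (1 - t • x) := by rw [mul_one]; noncomm_ring
    _ = (1 + t • x) * a * ((1 - t • x) * (1 + t • x)) * b * (1 - t • x) := by rw [this]
    _ = _ := by simp only [mul_assoc]

lemma R_equiv {D : HopfData H} (A : MAlg D E) (x : E) (hx : ∀ ω, A.fn ω x = epsi ω • x) (t : ℂ)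
    (ω : H) (c : E) : R x t (A.fn ω c) = A.fn ω (R x t c) := by
  have hl := fn_lin' A ω
  simp only [R_apply, hl.map_sub, hl.map_add, hl.map_smul, fn_mul_inv_left A x hx,
    fn_mul_inv_right A x hx]

/-- the coefficients of `R` -/
def Th (x : E) : Fin 3 → E → E := ![fun c => c, fun c => x * c - c * x, fun c => - (x * c * x)]

lemma R_sum (x : E) (t : ℂ) (c : E) : R x t c = ∑ m : Fin 3, (t ^ (m : ℕ)) • Th x m c := by
  simp [R_apply, Fin.sum_univ_three, Th, sub_eq_add_neg]

lemma R_ad (x : E) (hx : x * x = 0) (t : ℂ) (c : E) :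
    t • R x t (x * c - c * x) = ∑ m : Fin 3, (t ^ (m : ℕ) * (m : ℕ)) • Th x m c := by
  have h1 : x * (x * c - c * x) = - (x * c * x) := by
    rw [mul_sub, ← mul_assoc, hx, zero_mul, zero_sub, mul_assoc]
  have h2 : (x * c - c * x) * x = x * c * x := by
    rw [sub_mul, mul_assoc c, hx, mul_zero, sub_zero]
  have h3 : x * c * x * x = 0 := by rw [mul_assoc, hx, mul_zero]
  simp only [R_apply, h1, h2, Fin.sum_univ_three, Th]
  simp only [neg_mul, h3]
  simp
  rw [smul_smul, ← sq, ← neg_add', smul_neg, ← two_smul ℂ (x * c * x), smul_smul]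

/-- a multilinear cochain as a `MultilinearMap` -/
def toM (F : Raw H E n) (hF : IsML F) (ω : H) : MultilinearMap ℂ (fun _ : Fin (n + 1) => E) ℂ where
  toFun := F ω
  map_update_add' := by
    intro inst m i x y
    rw [Subsingleton.elim inst (instDecidableEqFin (n + 1))]
    exact hF.2.2.1 _ _ _ _ _
  map_update_smul' := by
    intro inst m i c x
    rw [Subsingleton.elim inst (instDecidableEqFin (n + 1))]
    exact hF.2.2.2 _ _ _ _ _

theorem conj_mem_Bd {D : HopfData H} (A : MAlg D E) (x : E) (hx : ∀ ω, A.fn ω x = epsi ω • x)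
    (hxx : x * x = 0) (F : Raw H E (n + 1)) (hF : F ∈ Z D A.fn (n + 1)) :
    pb (R x 1) (n + 1) F - F ∈ Bd D A.fn n := by
  have hML : IsML F := hF.1.1
  let w : (Fin (n + 2) → Fin 3) → Raw H E (n + 1) := fun e ω c => F ω fun i => Th x (e i) (c i)
  let d : (Fin (n + 2) → Fin 3) → ℕ := fun e => ∑ i, (e i : ℕ)
  have hpb : ∀ t, pb (R x t) (n + 1) F = ∑ e, t ^ d e • w e := by
    intro t
    funext ω c
    rw [pb_apply]
    simp only [R_sum]
    have := (toM F hML ω).map_sum (fun (i : Fin (n + 2)) (m : Fin 3) => t ^ (m : ℕ) • Th x m (c i))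
    refine this.trans ?_
    simp only [MultilinearMap.map_smul_univ, Finset.sum_apply, Finset.prod_pow_eq_pow_sum]
    rfl
  have hL : ∀ t : ℂ, t • Lop (fun c => x * c - c * x) (pb (R x t) (n + 1) F)
      = ∑ e, (t ^ d e * (d e : ℂ)) • w e := by
    intro t
    have hj : ∀ j, t • sl (fun c => x * c - c * x) j (pb (R x t) (n + 1) F)
        = ∑ e : Fin (n + 2) → Fin 3, (t ^ d e * ((e j : ℕ) : ℂ)) • w e := by
      intro j
      funext ω c
      simp only [Pi.smul_apply, sl, pb_apply, comp_update']
      rw [← (IsML.slot hML ω _ j).map_smul]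
      have e1 : Function.update (fun k => R x t (c k)) j (t • R x t (x * c j - c j * x))
          = fun i => ∑ m : Fin 3, ((if i = j then ((m : ℕ) : ℂ) else 1) * t ^ (m : ℕ)) • Th x m (c i) := by
        funext i
        by_cases h : i = j
        · subst h; rw [Function.update_self, R_ad x hxx]; simp only [if_true, mul_comm]
        · rw [Function.update_of_ne h, R_sum]; simp only [if_neg h, one_mul]
      rw [e1]
      refine ((toM F hML ω).map_sum _).trans ?_
      simp only [MultilinearMap.map_smul_univ, Finset.sum_apply, Finset.prod_mul_distrib,
        Finset.prod_pow_eq_pow_sum, Finset.prod_ite_eq', Finset.mem_univ, if_true]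
      refine Finset.sum_congr rfl fun e _ => ?_
      rw [mul_comm]
      rfl
    rw [Lop, Finset.smul_sum, Finset.sum_congr rfl fun j _ => hj j, Finset.sum_comm]
    refine Finset.sum_congr rfl fun e _ => ?_
    rw [← Finset.sum_smul, ← Finset.mul_sum]
    simp [d]
  have hF0 : F = pb (R x 0) (n + 1) F := by
    funext ω c
    rw [pb_apply]; simp [R_apply]
  have hmem := integrate_mem (Bd D A.fn n) Finset.univ d w (fun t => by
    rw [← hL]
    refine Submodule.smul_mem _ _ (L_mem_Bd A x hx _ ?_)
    exact pb_Z D _ (R_mul x hxx t) (R_equiv A x hx t) F hF)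
  rw [← hpb, ← hpb, ← hF0] at hmem
  exact hmem
end expo
end Mor

namespace Mor
section mat
variable {E : Type} [Ring E] [Algebra ℂ E] {n : ℕ}
variable {κ : Type} [Fintype κ] [DecidableEq κ]

lemma listsum_apply {α : Type} (l : List α) (g : α → Matrix κ κ E) (i j : κ) :
    (l.map g).sum i j = (l.map fun a => g a i j).sum := by
  induction l with
  | nil => simp
  | cons a l ih => simp [ih]

lemma listsum_finsum {α β W : Type} [AddCommMonoid W] (l : List α) (s : Finset β) (g : α → β → W) :
    (l.map fun a => ∑ k ∈ s, g a k).sum = ∑ k ∈ s, (l.map fun a => g a k).sum := by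
  induction l with
  | nil => simp
  | cons a l ih => simp [ih, Finset.sum_add_distrib]

/-- entrywise action on matrices -/
def mapM (κ : Type) [Fintype κ] [DecidableEq κ] {D : HopfData H} (A : MAlg D E) :
    MAlg D (Matrix κ κ E) where
  act :=
    { toFun := fun ω =>
        { toFun := fun M => Matrix.of fun i j => A.act ω (M i j)
          map_add' := fun M N => by ext i j; simp
          map_smul' := fun c M => by ext i j; simp }
      map_add' := fun a b => by ext M i j; simp
      map_smul' := fun c b => by ext M i j; simp }
  act_one := by
    ext M i j
    simp [A.act_one]
  act_mul ω η := by
    ext M i j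
    simp [A.act_mul]
  act_mul_mul ω M N := by
    ext i j
    rw [listsum_apply]
    simp only [LinearMap.coe_mk, AddHom.coe_mk, Matrix.of_apply, Matrix.mul_apply, map_sum,
      A.act_mul_mul, listsum_finsum]
  act_algOne ω := by
    ext i j
    by_cases h : i = j
    · subst h; simp [A.act_algOne]
    · simp [h]

lemma mapM_fn {D : HopfData H} (A : MAlg D E) (ω : H) (M : Matrix κ κ E) (i j : κ) :
    (mapM κ A).fn ω M i j = A.fn ω (M i j) := rfl

lemma map_lin {D : HopfData H} (A : MAlg D E) (M : Matrix κ κ E) :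
    IsLinearMap ℂ fun ω => (mapM κ A).fn ω M := fn_lin _ _

lemma matAct_eq {D : HopfData H} (A : MAlg D E) (P : MRep H κ)
    (hP : ∀ ω : H, P.π ω = epsi ω • 1) :
    matAct D P A.toRAct = (mapM κ A).fn := by
  funext ω M
  have hs : ∀ c : ℂ, ((c • (1 : Matrix κ κ ℂ)).map (algebraMap ℂ E)) = c • (1 : Matrix κ κ E) := by
    intro c
    ext i j
    by_cases h : i = j
    · subst h; simp [Algebra.algebraMap_eq_smul_one]
    · simp [h]
  have h1 : matAct D P A.toRAct ω M
      = ((D.sw 2 ω).map fun v => epsi (v 0) • (fun w : Fin 2 → H => epsi (w 1) •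
          (mapM κ A).fn (w 0) M) (Fin.removeNth 0 v)).sum := by
    simp only [matAct, matActR, hP, hs, epsi_Sinv]
    congr 1
    refine List.map_congr_left fun v _ => ?_
    rw [Matrix.smul_mul, Matrix.smul_mul, one_mul, Matrix.mul_smul, mul_one]
    rfl
  have hG' : MLin fun u : Fin 1 → H => (mapM κ A).fn (u 0) M := by
    intro v i
    rw [Subsingleton.elim i 0]
    simpa using fn_lin (mapM κ A) M
  have hG : MLin fun w : Fin 2 → H => epsi (w 1) • (mapM κ A).fn (w 0) M := by
    intro v i
    refine Fin.cases ?_ (fun i => ?_) i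
    · simp only [Function.update_self]
      have : ∀ y, (Function.update v 0 y) 1 = v 1 := fun y => by simp
      simp only [this]
      have h := fn_lin (mapM κ A) M
      exact ⟨fun a b => by rw [h.map_add, smul_add], fun a b => by rw [h.map_smul, smul_comm]⟩
    · rw [Subsingleton.elim i 0]
      have : ∀ y, (Function.update v (Fin.succ 0) y) 0 = v 0 := fun y => by simp
      simp only [this]
      have h2 : ∀ y, (Function.update v (Fin.succ 0) y) 1 = y := fun y => by simp
      simp only [h2]
      exact ⟨fun a b => by rw [epsi_lin.map_add, add_smul],
        fun a b => by rw [epsi_lin.map_smul, smul_eq_mul, mul_smul]⟩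
  rw [h1, sw_counit D 1 _ hG 0 ω]
  have h3 : ((D.sw 1 ω).map fun w : Fin 2 → H => epsi (w 1) • (mapM κ A).fn (w 0) M)
      = (D.sw 1 ω).map fun w : Fin 2 → H => epsi (w 1) •
        (fun u : Fin 1 → H => (mapM κ A).fn (u 0) M) (Fin.removeNth 1 w) := rfl
  rw [h3, sw_counit D 0 _ hG' 1 ω]
  simp [HopfData.sw]

/-- the trace map with closed indices -/
def Ps (κ : Type) [Fintype κ] [DecidableEq κ] (n : ℕ) : Raw H E n →ₗ[ℂ] Raw H (Matrix κ κ E) n where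
  toFun f := fun ω M => ∑ k : Fin (n + 1) → κ, f ω fun i => M i (k i) (k (i + 1))
  map_add' f g := by
    funext ω M; simp [Finset.sum_add_distrib]
  map_smul' c f := by
    funext ω M; simp [Finset.mul_sum]

lemma Ps_apply (f : Raw H E n) (ω : H) (M : Fin (n + 1) → Matrix κ κ E) :
    Ps κ n f ω M = ∑ k : Fin (n + 1) → κ, f ω fun i => M i (k i) (k (i + 1)) := rfl

lemma Ps_InC {D : HopfData H} (A : MAlg D E) (f : Raw H E n) (hf : InC D A.fn f) :
    InC D (mapM κ A).fn (Ps κ n f) := by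
  have hu : ∀ (M : Fin (n + 1) → Matrix κ κ E) (i : Fin (n + 1)) (X : Matrix κ κ E)
      (k : Fin (n + 1) → κ),
      (fun j => (Function.update M i X) j (k j) (k (j + 1)))
        = Function.update (fun j => M j (k j) (k (j + 1))) i (X (k i) (k (i + 1))) := by
    intro M i X k
    funext j
    by_cases h : j = i
    · subst h; simp
    · simp [h]
  refine ⟨⟨fun ω η b => ?_, fun c ω b => ?_, fun ω b i y z => ?_,
    fun ω b i c y => ?_⟩, fun ω η b => ?_⟩
  · simp only [Ps_apply, ← Finset.sum_add_distrib, hf.1.1]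
  · simp only [Ps_apply, Finset.mul_sum, hf.1.2.1]
  · simp only [Ps_apply, ← Finset.sum_add_distrib, hu, Matrix.add_apply, hf.1.2.2.1]
  · simp only [Ps_apply, Finset.mul_sum, hu, Matrix.smul_apply, hf.1.2.2.2]
  · simp only [Ps_apply, listsum_finsum, Finset.mul_sum, mapM_fn, hf.2 ω η]

lemma Ps_tL {D : HopfData H} (A : MAlg D E) (f : Raw H E n) :
    tL D (mapM κ A).fn n (Ps κ n f) = Ps κ n (tL D A.fn n f) := by
  funext ω M
  simp only [tL, LinearMap.coe_mk, AddHom.coe_mk, tRaw, Ps_apply]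
  rw [← listsum_finsum]
  congr 1
  refine List.map_congr_left fun p _ => ?_
  refine Fintype.sum_equiv (Equiv.arrowCongr (Equiv.addRight (1 : Fin (n + 1))).symm (Equiv.refl κ)) _ _
    fun k => ?_
  congr 1
  have hk : ∀ i, (Equiv.arrowCongr (Equiv.addRight (1 : Fin (n + 1))).symm (Equiv.refl κ)) k i
     = k (i + 1) := fun i => rfl
  simp only [hk]
  funext i
  refine Fin.cases ?_ (fun i => ?_) i
  · simp [mapM_fn]
  · simp only [Fin.cons_succ, Fin.coeSucc_eq_succ]

lemma Ps_cL (f : Raw H E n) (hf : IsML f) (i : Fin (n + 1)) :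
    cL H n i (Ps κ n f) = Ps κ (n + 1) (cL H n i f) := by
  funext ω M
  simp only [cL, LinearMap.coe_mk, AddHom.coe_mk, Ps_apply]
  have h1 : ∀ k : Fin (n + 1) → κ, f ω (fun j => contract i M j (k j) (k (j + 1)))
      = ∑ r : κ, f ω (Function.update (fun j => contract i M j (k j) (k (j + 1))) i
         (M i.castSucc (k i) r * M i.succ r (k (i + 1)))) := by
    intro k
    have hl := IsML.slot hf ω (fun j => contract i M j (k j) (k (j + 1))) i
    have := map_sum (hl.mk' _) (fun r => M i.castSucc (k i) r * M i.succ r (k (i + 1))) Finset.univ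
    simp only [IsLinearMap.mk'_apply] at this
    rw [← this]
    congr 1
    symm
    rw [Function.update_eq_self_iff]
    simp [contract, Matrix.mul_apply]
  simp only [h1]
  rw [Finset.sum_comm, ← Finset.sum_product', Finset.univ_product_univ]
  refine Fintype.sum_equiv (Fin.insertNthEquiv (fun _ => κ) i.succ) _ _ fun x => ?_
  obtain ⟨r, k⟩ := x
  set K := Fin.insertNthEquiv (fun _ => κ) i.succ (r, k) with hK
  have hA : ∀ j : Fin (n + 1), j ≤ i → K j.castSucc = k j := by
    intro j hj
    have : j.castSucc = i.succ.succAbove j := by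
      rw [Fin.succAbove_of_castSucc_lt]
      rw [Fin.lt_def]; simp; omega
    rw [this, hK]; simp
  have hC : ∀ j : Fin (n + 1), i < j → K j.succ = k j := by
    intro j hj
    have : j.succ = i.succ.succAbove j := by
      rw [Fin.succAbove_of_le_castSucc]
      rw [Fin.le_def]; simp; omega
    rw [this, hK]; simp
  have hr : K i.succ = r := by rw [hK]; simp
  have hB : ∀ j : Fin (n + 1), i ≤ j → K (j.succ + 1) = k (j + 1) := by
    intro j
    refine Fin.lastCases (fun _ => ?_) (fun j hj => ?_) j
    · rw [Fin.succ_last, Fin.last_add_one, Fin.last_add_one]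
      exact hA 0 (Fin.zero_le _)
    · have h1 : (j.castSucc.succ + 1 : Fin (n + 2)) = j.succ.succ := by
        rw [Fin.succ_castSucc, Fin.coeSucc_eq_succ]
      rw [h1, Fin.coeSucc_eq_succ]
      exact hC _ (lt_of_le_of_lt hj (Fin.castSucc_lt_succ))
  have hD : ∀ j : Fin (n + 1), j < i → K (j.castSucc + 1) = k (j + 1) := by
    intro j
    refine Fin.lastCases (fun h => ?_) (fun j hj => ?_) j
    · exact absurd h (not_lt.2 (Fin.le_last _))
    · rw [Fin.coeSucc_eq_succ, Fin.coeSucc_eq_succ, Fin.succ_castSucc]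
      exact hA _ (Fin.castSucc_lt_iff_succ_le.1 hj)
  congr 1
  funext j
  simp only [contract]
  rcases lt_trichotomy j i with h | h | h
  · rw [if_pos (by exact h), Function.update_of_ne h.ne, if_pos (by exact h), hA j h.le, hD j h]
  · subst h
    simp only [Function.update_self, lt_irrefl, if_false, if_true]
    rw [hA j le_rfl, Fin.coeSucc_eq_succ, hr, hB j le_rfl]
  · have h1 : ¬ (j : ℕ) < i := not_lt.2 h.le
    have h2 : ¬ (j : ℕ) = i := fun hh => h.ne' (Fin.ext hh)
    rw [if_neg h1, if_neg h2, Function.update_of_ne h.ne', if_neg h1, if_neg h2, hC j h, hB j h.le]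

lemma Ps_Z {D : HopfData H} (A : MAlg D E) (f : Raw H E n) (hf : f ∈ Z D A.fn n) :
    Ps κ n f ∈ Z D (mapM κ A).fn n := by
  rw [mem_Z] at *
  obtain ⟨h1, h2, h3⟩ := hf
  refine ⟨Ps_InC A f h1, ?_, ?_⟩
  · conv_rhs => rw [← h2]
    simp only [lam, LinearMap.smul_apply, map_smul, Ps_tL A]
  · have : bL D (mapM κ A).fn n (Ps κ n f) = Ps κ (n + 1) (bL D A.fn n f) := by
      simp only [bL, LinearMap.sum_apply, map_sum]
      refine Finset.sum_congr rfl fun i _ => ?_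
      simp only [eN, dN, LinearMap.smul_apply, map_smul]
      split_ifs
      · rw [Ps_cL f h1.1]
      · simp only [LinearMap.comp_apply]
        rw [Ps_cL f h1.1, Ps_tL A]
    rw [this, h3, map_zero]

lemma PsiRaw_eq {D : HopfData H} (P : MRep H κ)
    (hP : ∀ ω : H, P.π ω = epsi ω • 1) (f : Raw H E n) (hf : IsML f) :
    PsiRaw D P f = Ps κ n f := by
  funext ω M
  simp only [PsiRaw, hP, epsi_Sinv, listsum_finsum, Ps_apply]
  have h1 : ∀ K : Fin (n + 2) → κ,
      ((D.Δl ω).map fun p => (epsi p.2 • (1 : Matrix κ κ ℂ)) (K (Fin.last (n + 1))) (K 0) *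
          f p.1 fun i => M i (K i.castSucc) (K i.succ)).sum
      = if K (Fin.last (n + 1)) = K 0 then f ω fun i => M i (K i.castSucc) (K i.succ) else 0 := by
    intro K
    rw [← dl_counit_right D (fun ω => f ω fun i => M i (K i.castSucc) (K i.succ)) (IsML.lin hf _) ω]
    split_ifs with h
    · simp [h]
    · simp [h]
  simp only [h1]
  rw [← Equiv.sum_comp (Fin.insertNthEquiv (fun _ => κ) (Fin.last (n + 1)))]
  rw [← Finset.univ_product_univ, Finset.sum_product_right]
  refine Finset.sum_congr rfl fun k _ => ?_
  have h2 : ∀ r : κ, (Fin.insertNthEquiv (fun _ => κ) (Fin.last (n + 1))) (r, k)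
     = (Fin.snoc k r : Fin (n + 2) → κ) := by
    intro r; simp [Fin.insertNthEquiv]
  have h3 : ∀ r : κ, (Fin.snoc k r : Fin (n + 2) → κ) 0 = k 0 := fun r => by
    rw [← Fin.castSucc_zero, Fin.snoc_castSucc]
  simp only [h2, h3, Fin.snoc_last, Fin.snoc_castSucc]
  rw [Finset.sum_ite_eq' Finset.univ (k 0), if_pos (Finset.mem_univ _)]
  congr 1
  funext i
  congr 1
  refine Fin.lastCases ?_ (fun i => ?_) i
  · rw [Fin.succ_last, Fin.snoc_last, Fin.last_add_one]
  · rw [Fin.succ_castSucc, Fin.snoc_castSucc, Fin.coeSucc_eq_succ]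
end mat
end Mor

namespace Mor
section morita
variable {C : Type} [Ring C] [Algebra ℂ C] {n : ℕ}
variable {ι : Type} [Fintype ι] [DecidableEq ι]

lemma ML_zero (f : Raw H C n) (hf : IsML f) (ω : H) (c : Fin (n + 1) → C) (i : Fin (n + 1))
    (h : c i = 0) : f ω c = 0 := by
  have := (IsML.slot hf ω c i).map_zero
  rwa [← h, Function.update_eq_self] at this

/-- entries of the homomorphism `φ` -/
def phE (a : ι → C) (c : C) : Option ι → Option ι → C
  | none, none => c
  | some k, none => a k * c
  | _, some _ => 0

/-- the homomorphism `φ` -/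
def ph (a : ι → C) : C →ₗ[ℂ] Matrix (Option ι) (Option ι) C where
  toFun c := Matrix.of (phE a c)
  map_add' c d := by
    ext i j
    rcases i with _ | i <;> rcases j with _ | j <;> simp [phE, mul_add]
  map_smul' r c := by
    ext i j
    rcases i with _ | i <;> rcases j with _ | j <;> simp [phE]

lemma ph_apply (a : ι → C) (c : C) (i j : Option ι) : ph a c i j = phE a c i j := rfl

lemma ph_mul (a : ι → C) (c d : C) : ph a (c * d) = ph a c * ph a d := by
  ext i j
  rw [Matrix.mul_apply, Fintype.sum_option]
  rcases i with _ | i <;> rcases j with _ | j <;> simp [ph_apply, phE, mul_assoc]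

lemma ph_equiv {D : HopfData H} (A : MAlg D C) (a : ι → C)
    (ha : ∀ k ω, A.fn ω (a k) = epsi ω • a k) (ω : H) (c : C) :
    ph a (A.fn ω c) = (mapM (Option ι) A).fn ω (ph a c) := by
  ext i j
  rw [mapM_fn]
  rcases i with _ | i <;> rcases j with _ | j <;>
    simp [ph_apply, phE, fn_mul_inv_left A _ (ha _), (fn_lin' A ω).map_zero]

/-- entries of the nilpotent element -/
def nilE (b : ι → C) : Option ι → Option ι → C
  | none, some l => - b l
  | _, _ => 0

/-- the nilpotent element -/
def nil (b : ι → C) : Matrix (Option ι) (Option ι) C := Matrix.of (nilE b)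

lemma nil_apply (b : ι → C) (i j : Option ι) : nil b i j = nilE b i j := rfl

lemma nil_sq (b : ι → C) : nil b * nil b = 0 := by
  ext i j
  rw [Matrix.mul_apply, Fintype.sum_option]
  rcases i with _ | i <;> rcases j with _ | j <;> simp [nil_apply, nilE]

lemma nil_inv {D : HopfData H} (A : MAlg D C) (b : ι → C)
    (hb : ∀ k ω, A.fn ω (b k) = epsi ω • b k) (ω : H) :
    (mapM (Option ι) A).fn ω (nil b) = epsi ω • nil b := by
  ext i j
  rw [mapM_fn]
  rcases i with _ | i <;> rcases j with _ | j <;>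
    simp [nil_apply, nilE, (fn_lin' A ω).map_zero, (fn_lin' A ω).map_neg, hb]

/-- entries of the conjugated homomorphism -/
def psE (a b : ι → C) (c : C) : Option ι → Option ι → C
  | none, _ => 0
  | some k, none => a k * c
  | some k, some l => a k * c * b l

lemma R_ph (a b : ι → C) (hab : ∑ k, b k * a k = 1) (c : C) :
    R (nil b) 1 (ph a c) = Matrix.of (psE a b c) := by
  have h1 : nil b * ph a c = Matrix.of fun i j =>
      (match i, j with | none, none => - c | _, _ => 0 : C) := by
    ext i j
    rw [Matrix.mul_apply, Fintype.sum_option]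
    rcases i with _ | i <;> rcases j with _ | j <;> simp [nil_apply, nilE, ph_apply, phE]
    simp only [← mul_assoc, ← Finset.sum_mul, hab, one_mul]
  rw [R_apply, h1]
  ext i j
  simp only [one_smul, one_pow, Matrix.sub_apply, Matrix.add_apply, Matrix.mul_apply,
    Fintype.sum_option, Matrix.of_apply]
  rcases i with _ | i <;> rcases j with _ | j <;> simp [nil_apply, nilE, ph_apply, phE, psE]

lemma pb_ph (a : ι → C) (f : Raw H C n) (hf : IsML f) :
    pb (ph a) n (Ps (Option ι) n f) = f := by
  funext ω c
  rw [pb_apply, Ps_apply, Finset.sum_eq_single (fun _ => none)]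
  · rfl
  · intro K _ hK
    obtain ⟨i, hi⟩ := Function.ne_iff.1 hK
    obtain ⟨l, hl⟩ := Option.ne_none_iff_exists'.1 hi
    refine ML_zero f hf ω _ (i - 1) ?_
    rw [sub_add_cancel, hl, ph_apply]
    rcases K (i - 1) with _ | k <;> rfl
  · intro h; exact absurd (Finset.mem_univ _) h

lemma pb_ps (a b : ι → C) (hab : ∑ k, b k * a k = 1) (f : Raw H C n) (hf : IsML f) (ω : H)
    (c : Fin (n + 1) → C) :
    pb (ph a) n (pb (R (nil b) 1) n (Ps (Option ι) n f)) ω c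
      = ∑ k : Fin (n + 1) → ι, f ω fun i => a (k i) * c i * b (k (i + 1)) := by
  rw [pb_apply, pb_apply, Ps_apply]
  simp only [R_ph a b hab, Matrix.of_apply]
  symm
  refine Finset.sum_of_injOn (fun k i => some (k i)) ?_ ?_ ?_ ?_
  · intro k _ k' _ h
    funext i
    exact Option.some_injective _ (congrFun h i)
  · intro k _; simp
  · intro K _ hK
    have : ∃ i, K i = none := by
      by_contra hcon
      push Not at hcon
      choose k hk using fun i => Option.ne_none_iff_exists'.1 (hcon i)
      refine hK ⟨k, by simp, ?_⟩
      funext i; exact (hk i).symm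
    obtain ⟨i, hi⟩ := this
    refine ML_zero f hf ω _ i ?_
    rw [hi]; rfl
  · intro k _; rfl

theorem morita_Bd {D : HopfData H} (A : MAlg D C) (a b : ι → C)
    (ha : ∀ k ω, A.fn ω (a k) = epsi ω • a k) (hb : ∀ k ω, A.fn ω (b k) = epsi ω • b k)
    (hab : ∑ k, b k * a k = 1) (f : Raw H C (n + 1)) (hf : f ∈ Z D A.fn (n + 1)) :
    (fun ω c => ∑ k : Fin (n + 2) → ι, f ω fun i => a (k i) * c i * b (k (i + 1))) - f
      ∈ Bd D A.fn n := by
  have hML : IsML f := hf.1.1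
  have h1 := conj_mem_Bd (mapM (Option ι) A) (nil b) (nil_inv A b hb) (nil_sq b)
    (Ps (Option ι) (n + 1) f) (Ps_Z A f hf)
  have h2 := pb_Bd D (act' := A.fn) (ph a) (ph_mul a) (ph_equiv A a ha) _ h1
  rw [map_sub, pb_ph a f hML] at h2
  have h3 : pb (ph a) (n + 1) (pb (R (nil b) 1) (n + 1) (Ps (Option ι) (n + 1) f))
      = fun ω c => ∑ k : Fin (n + 2) → ι, f ω fun i => a (k i) * c i * b (k (i + 1)) := by
    funext ω c; exact pb_ps a b hab f hML ω c
  rwa [h3] at h2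

theorem morita_zero {D : HopfData H} (A : MAlg D C) (a b : ι → C)
    (hb : ∀ k ω, A.fn ω (b k) = epsi ω • b k)
    (hab : ∑ k, b k * a k = 1) (f : Raw H C 0) (hf : f ∈ Z D A.fn 0) :
    (fun ω c => ∑ k : Fin 1 → ι, f ω fun i => a (k i) * c i * b (k (i + 1))) = f := by
  have hML : IsML f := hf.1.1
  haveI : Subsingleton (Fin (0 + 1)) := inferInstanceAs (Subsingleton (Fin 1))
  have hcomm : ∀ ω (y z : C), (∀ ω, A.fn ω z = epsi ω • z) →
      f ω (fun _ => y * z) = f ω (fun _ => z * y) := by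
    intro ω y z hz
    have h : ∑ i : Fin 2, ((-1 : ℂ) ^ (i : ℕ)) * dRaw D A.fn i f ω ![y, z] = 0 := hf.2.2 ω ![y, z]
    rw [Fin.sum_univ_two] at h
    have h0 : dRaw D A.fn (0 : Fin 2) f ω ![y, z] = f ω (fun _ => y * z) := by
      simp only [dRaw]
      rw [dif_pos (by simp)]
      congr 1
      funext j
      rw [Subsingleton.elim j 0]
      simp [contract]
    have h1 : dRaw D A.fn (1 : Fin 2) f ω ![y, z] = f ω (fun _ => z * y) := by
      simp only [dRaw]
      rw [dif_neg (by simp)]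
      simp only [tRaw]
      rw [← dl_counit_right D (fun ω => f ω fun _ => z * y) (IsML.lin hML _) ω]
      congr 1
      refine List.map_congr_left fun p _ => ?_
      rw [contract_zero_cons]
      have e1 : (Function.update (fun i : Fin 1 => ![y, z] i.castSucc) 0
          (A.fn p.2 (![y, z] (Fin.last 1)) * (![y, z] (Fin.castSucc 0))))
          = Function.update (fun _ : Fin 1 => z * y) 0 (epsi p.2 • (z * y)) := by
        funext j
        rw [Subsingleton.elim j 0]
        simp only [Function.update_self]
        change A.fn p.2 z * y = _
        rw [hz, smul_mul_assoc]
      have e2 := (IsML.slot hML p.1 (fun _ : Fin 1 => z * y) 0).map_smul (epsi p.2) (z * y)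
      refine (congrArg (f p.1) e1).trans (e2.trans ?_)
      simp
    rw [h0, h1] at h
    simp at h
    linear_combination h
  funext ω c
  have hs := (IsML.slot hML ω c 0)
  have hu : ∀ y : C, Function.update c 0 y = fun _ => y := by
    intro y; funext j; rw [Subsingleton.elim j 0]; simp
  simp only [hu] at hs
  rw [Fintype.sum_equiv (Equiv.funUnique (Fin 1) ι) _ (fun k => f ω fun _ => a k * c 0 * b k)]
  · have h1 : ∀ k, (f ω fun _ => a k * c 0 * b k) = f ω fun _ => b k * a k * c 0 := by
      intro k
      rw [hcomm ω _ _ (hb k), mul_assoc]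
    simp only [h1]
    have := map_sum (hs.mk' _) (fun k => b k * a k * c 0) Finset.univ
    simp only [IsLinearMap.mk'_apply] at this
    rw [← this, ← Finset.sum_mul, hab, one_mul]
    congr 1
    funext j; rw [Subsingleton.elim j 0]
  · intro k
    congr 1
    funext i
    rw [Subsingleton.elim i 0]
    rfl
end morita
end Mor

namespace Mor
section rankone
variable {B : Type} [Ring B] [Algebra ℂ B] {n : ℕ}
variable {ι : Type} [Fintype ι] [DecidableEq ι]

lemma rank_one (p : Matrix ι ι ℂ) (hp : p * p = p) (htr : Matrix.trace p = 1) :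
    ∃ u v : ι → ℂ, (∀ i j, p i j = u i * v j) ∧ ∑ i, u i * v i = 1 := by
  have hT : IsIdempotentElem (Matrix.toLin' p) := by
    change Matrix.toLin' p * Matrix.toLin' p = _
    rw [Module.End.mul_eq_comp, ← Matrix.toLin'_mul, hp]
  have h1 := (LinearMap.IsIdempotentElem.isProj_range _ hT).trace
  have h2 : LinearMap.trace ℂ (ι → ℂ) (Matrix.toLin' p) = 1 := by
    rw [← htr]
    exact Matrix.trace_toLin'_eq p
  rw [h2] at h1
  have h3 : Module.finrank ℂ (LinearMap.range (Matrix.toLin' p)) = 1 := by exact_mod_cast h1.symm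
  obtain ⟨w, -, hw⟩ := finrank_eq_one_iff'.1 h3
  choose c hc using fun j : ι => hw ⟨Matrix.toLin' p (Pi.single j 1), LinearMap.mem_range_self _ _⟩
  have key : ∀ i j, p i j = (w : ι → ℂ) i * c j := by
    intro i j
    have := congrFun (congrArg Subtype.val (hc j)) i
    simp at this
    rw [← this, mul_comm]
  refine ⟨w, c, key, ?_⟩
  rw [← htr, Matrix.trace]
  simp [key]

/-- the homomorphism `b ↦ p ⊗ b` -/
def Ph (p : Matrix ι ι ℂ) : B →ₗ[ℂ] Matrix ι ι B where
  toFun b := Matrix.of fun i j => p i j • b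
  map_add' a b := by ext i j; simp
  map_smul' c b := by ext i j; simp [smul_comm c]

lemma Ph_apply (p : Matrix ι ι ℂ) (b : B) (i j : ι) : Ph p b i j = p i j • b := rfl

lemma phiRaw_eq (p : Matrix ι ι ℂ) (f : Raw H (Matrix ι ι B) n) : phiRaw p f = pb (Ph p) n f := rfl

lemma Ph_mul (p : Matrix ι ι ℂ) (hp : p * p = p) (a b : B) : Ph p (a * b) = Ph p a * Ph p b := by
  ext i j
  rw [Matrix.mul_apply]
  simp only [Ph_apply, smul_mul_smul_comm]
  rw [← Finset.sum_smul, ← Matrix.mul_apply, hp]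

lemma Ph_equiv {D : HopfData H} (A : MAlg D B) (p : Matrix ι ι ℂ) (ω : H) (b : B) :
    Ph p (A.fn ω b) = (mapM ι A).fn ω (Ph p b) := by
  ext i j
  rw [mapM_fn, Ph_apply, Ph_apply]
  exact ((A.act ω).map_smul _ _).symm

lemma sum_prod_one (p : Matrix ι ι ℂ) (u v : ι → ℂ) (huv : ∀ i j, p i j = u i * v j)
    (h1 : ∑ i, u i * v i = 1) : ∑ k : Fin (n + 1) → ι, ∏ i, p (k i) (k (i + 1)) = 1 := by
  have : ∀ k : Fin (n + 1) → ι, ∏ i, p (k i) (k (i + 1)) = ∏ i, (u (k i) * v (k i)) := by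
    intro k
    simp only [huv, Finset.prod_mul_distrib]
    congr 1
    exact Fintype.prod_equiv (Equiv.addRight 1) _ _ fun i => rfl
  simp only [this]
  rw [← Fintype.prod_sum (fun (_ : Fin (n + 1)) j => u j * v j)]
  simp [h1]

lemma phi_Ps (p : Matrix ι ι ℂ) (hp : p * p = p) (htr : Matrix.trace p = 1)
    (f : Raw H B n) (hf : IsML f) : pb (Ph p) n (Ps ι n f) = f := by
  obtain ⟨u, v, huv, h1⟩ := rank_one p hp htr
  funext ω b
  rw [pb_apply, Ps_apply]
  have : ∀ k : Fin (n + 1) → ι, (f ω fun i => Ph p (b i) (k i) (k (i + 1)))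
      = (∏ i, p (k i) (k (i + 1))) * f ω b := by
    intro k
    exact (toM f hf ω).map_smul_univ (fun i => p (k i) (k (i + 1))) b
  refine (Finset.sum_congr rfl fun k _ => this k).trans ?_
  rw [← Finset.sum_mul, sum_prod_one p u v huv h1, one_mul]

def ea (u : ι → ℂ) (k : ι) : Matrix ι ι B := Matrix.of fun i j => (if j = k then u i else 0) • (1 : B)
def eb (v : ι → ℂ) (l : ι) : Matrix ι ι B := Matrix.of fun i j => (if i = l then v j else 0) • (1 : B)

lemma ea_inv {D : HopfData H} (A : MAlg D B) (u : ι → ℂ) (k : ι) (ω : H) :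
    (mapM ι A).fn ω (ea u k) = epsi ω • ea u k := by
  ext i j
  rw [mapM_fn]
  refine ((A.act ω).map_smul _ _).trans ?_
  rw [A.act_algOne, smul_comm]
  rfl

lemma eb_inv {D : HopfData H} (A : MAlg D B) (u : ι → ℂ) (k : ι) (ω : H) :
    (mapM ι A).fn ω (eb u k) = epsi ω • eb u k := by
  ext i j
  rw [mapM_fn]
  refine ((A.act ω).map_smul _ _).trans ?_
  rw [A.act_algOne, smul_comm]
  rfl

lemma eb_ea (u v : ι → ℂ) (h1 : ∑ i, u i * v i = 1) :
    ∑ k, (eb v k * ea u k : Matrix ι ι B) = 1 := by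
  ext i j
  rw [Matrix.sum_apply]
  have : ∀ k, (eb v k * ea u k : Matrix ι ι B) i j
      = (if i = k then (if j = k then (1 : B) else 0) else 0) := by
    intro k
    rw [Matrix.mul_apply]
    simp only [eb, ea, Matrix.of_apply, smul_mul_smul_comm, mul_one]
    rw [← Finset.sum_smul]
    by_cases hi : i = k <;> by_cases hj : j = k <;> simp [hi, hj]
    rw [show ∑ x, v x * u x = 1 by rw [← h1]; exact Finset.sum_congr rfl fun x _ => mul_comm _ _,
      one_smul]
  simp only [this]
  simp [Matrix.one_apply, eq_comm]

lemma ea_mul_eb (p : Matrix ι ι ℂ) (u v : ι → ℂ) (huv : ∀ i j, p i j = u i * v j)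
    (M : Matrix ι ι B) (k l : ι) : ea u k * M * eb v l = Ph p (M k l) := by
  ext i j
  rw [Matrix.mul_apply, Ph_apply, huv]
  simp only [Matrix.mul_apply, ea, eb, Matrix.of_apply, ite_smul, zero_smul, ite_mul, zero_mul,
    mul_ite, mul_zero, Finset.sum_ite_eq', Finset.mem_univ, if_true, smul_mul_assoc, one_mul,
    mul_smul_comm, mul_one, smul_smul]
  rw [mul_comm]

lemma Ps_pb (p : Matrix ι ι ℂ) (u v : ι → ℂ) (huv : ∀ i j, p i j = u i * v j)
    (f : Raw H (Matrix ι ι B) n) :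
    Ps ι n (pb (Ph p) n f) = fun ω c => ∑ k : Fin (n + 1) → ι,
      f ω fun i => ea u (k i) * c i * eb v (k (i + 1)) := by
  funext ω c
  rw [Ps_apply]
  simp only [pb_apply, ea_mul_eb p u v huv]
end rankone
end Mor

/-- if `X` is a finite-dimensional vector space with the trivial right
`H`-action, then `[Ψⁿ] : HC^n_H(B) → HC^n_H(End(X) ⊗ B)` is an isomorphism with
inverse `[Φⁿ_p]`, for any one-dimensional idempotent `p ∈ End(X)`. (Cyclic
cohomology is computed by the cyclic complex `(Ker(1-λ), b)`; the two composites
are the identity on cohomology.) -/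
theorem Psi_is_Morita_isomorphism
    {H : Type} [Ring H] [HopfAlgebra ℂ H] (D : HopfData H)
    {B : Type} [Ring B] [Algebra ℂ B] (A : MAlg D B)
    (ι : Type) [Fintype ι] [DecidableEq ι] (P : MRep H ι)
    (hP : ∀ ω : H, P.π ω = epsi ω • 1)
    (p : Matrix ι ι ℂ) (hp : p * p = p) (htr : Matrix.trace p = 1) :
    -- Ψ and Φ_p map cyclic cocycles to cyclic cocycles
    (∀ (n : ℕ) (f : Raw H B n), IsCocycle D A.fn f →
      IsCocycle D (matAct D P A.toRAct) (PsiRaw D P f)) ∧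
    (∀ (n : ℕ) (f : Raw H (Matrix ι ι B) n), IsCocycle D (matAct D P A.toRAct) f →
      IsCocycle D A.fn (phiRaw p f)) ∧
    -- Φ_p ∘ Ψ is the identity already on cochains
    (∀ (n : ℕ) (f : Raw H B n), InC D A.fn f → phiRaw p (PsiRaw D P f) = f) ∧
    -- Ψ ∘ Φ_p is the identity on cyclic cohomology
    (∀ (n : ℕ) (f : Raw H (Matrix ι ι B) (n + 1)),
      IsCocycle D (matAct D P A.toRAct) f →
      ∃ g : Raw H (Matrix ι ι B) n, InC D (matAct D P A.toRAct) g ∧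
        IsCyc D (matAct D P A.toRAct) g ∧
        PsiRaw D P (phiRaw p f) = f + bRaw D (matAct D P A.toRAct) g) ∧
    (∀ f : Raw H (Matrix ι ι B) 0, IsCocycle D (matAct D P A.toRAct) f →
      PsiRaw D P (phiRaw p f) = f) := by
  rw [Mor.matAct_eq A P hP]
  obtain ⟨u, v, huv, h1⟩ := Mor.rank_one p hp htr
  have part2 : ∀ (n : ℕ) (f : Raw H (Matrix ι ι B) n), IsCocycle D (Mor.mapM ι A).fn f →
      IsCocycle D A.fn (phiRaw p f) := fun n f hf =>
    show Mor.pb (Mor.Ph p) n f ∈ Mor.Z D A.fn n from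
      Mor.pb_Z D (Mor.Ph p) (Mor.Ph_mul p hp) (Mor.Ph_equiv A p) f hf
  refine ⟨fun n f hf => ?_, part2, fun n f hf => ?_, fun n f hf => ?_, fun f hf => ?_⟩
  · rw [Mor.PsiRaw_eq P hP f hf.1.1]
    exact Mor.Ps_Z A f hf
  · rw [Mor.PsiRaw_eq P hP f hf.1, Mor.phiRaw_eq]
    exact Mor.phi_Ps p hp htr f hf.1
  · rw [Mor.PsiRaw_eq P hP _ (part2 _ f hf).1.1, Mor.phiRaw_eq, Mor.Ps_pb p u v huv]
    have h := Mor.morita_Bd (Mor.mapM ι A) (Mor.ea u) (Mor.eb v) (Mor.ea_inv A u) (Mor.eb_inv A v)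
      (Mor.eb_ea u v h1) f hf
    obtain ⟨g, hg, hc, he⟩ := (Mor.mem_Bd D _ _).1 h
    exact ⟨g, hg, hc, by rw [← he, add_sub_cancel]⟩
  · rw [Mor.PsiRaw_eq P hP _ (part2 _ f hf).1.1, Mor.phiRaw_eq, Mor.Ps_pb p u v huv]
    exact Mor.morita_zero (Mor.mapM ι A) (Mor.ea u) (Mor.eb v) (Mor.eb_inv A v)
      (Mor.eb_ea u v h1) f hf

end
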